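/- arXiv:1601.07316 — 6 statements merged into one kernel-verified Lean document; each statement's English description precedes it below -/
import Mathlib

section
/- Let K be a field and f ∈ K[x] a polynomial whose degree is not divisible by char(K). If f has at least two distinct critical points and all distinct critical values, then the monodromy group Mon(f) is a doubly transitive permutation group (in particular, it is primitive). -/
open Polynomial

noncomputable section

/-- The polynomial `f(X) - t` over `K(t)`, whose Galois group (viewed as a permutation group
of the roots in a splitting field) is the monodromy group `Mon(f)` of `f`. -/
def monodromyPoly (K : Type*) [Field K] (f : K[X]) : Polynomial (RatFunc K) :=
  f.map (algebraMap K (RatFunc K)) - C RatFunc.X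

/-- A group action is doubly transitive if any ordered pair of distinct points can be mapped
to any other ordered pair of distinct points. -/
def IsDoublyTransitive (G α : Type*) [Group G] [MulAction G α] : Prop :=
  ∀ x₁ x₂ y₁ y₂ : α, x₁ ≠ x₂ → y₁ ≠ y₂ → ∃ g : G, g • x₁ = y₁ ∧ g • x₂ = y₂

/-- A group action is primitive if it is transitive and preserves no nontrivial partition,
i.e. every block is trivial (a subsingleton or the whole set). -/
def IsPrimitiveAction (G α : Type*) [Group G] [MulAction G α] : Prop :=
  MulAction.IsPretransitive G α ∧
    ∀ B : Set α, (∀ g : G, (fun x => g • x) '' B = B ∨ Disjoint ((fun x => g • x) '' B) B) →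
      B.Subsingleton ∨ B = Set.univ

namespace Polynomial

section WeightedDegree

variable {k : Type*} [Field k]

/-- The ring homomorphism `k[X][Y] → k[Y][X]` mapping `X` to `X` and `Y` to `X * Y`. The degree in
`X` of the image of a bivariate polynomial is its total degree. -/
def homogenizer (k : Type*) [Field k] : k[X][X] →+* k[X][X] :=
  eval₂RingHom (mapRingHom C) (X * C X)

theorem coeff_coeff_homogenizer (p : k[X][X]) (m j : ℕ) :
    ((homogenizer k p).coeff m).coeff j = if j ≤ m then (p.coeff j).coeff (m - j) else 0 := by
  induction p using Polynomial.induction_on' with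
  | add p q hp hq =>
    rw [map_add, coeff_add, coeff_add, hp, hq]
    split_ifs <;> simp
  | monomial n a =>
    have : homogenizer k (monomial n a) = a.map C * X ^ n * C (X ^ n) := by
      simp [homogenizer, mul_pow, mul_assoc, mul_comm (X ^ n)]
    rw [this, coeff_mul_C, coeff_mul_X_pow' (a.map C)]
    by_cases hjn : j = n
    · subst hjn
      split_ifs <;> simp
    · split_ifs <;> simp [coeff_monomial, coeff_X_pow, Ne.symm hjn, hjn]

/-- If the product of two monic bivariate polynomials has total degree equal to its degree in the
main variable, then so have the factors. -/
theorem add_le_natDegree_of_monic_mul {p q : k[X][X]} (hp : p.Monic) (hq : q.Monic)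
    (h : ∀ i j, ((p * q).coeff j).coeff i ≠ 0 → i + j ≤ p.natDegree + q.natDegree)
    {i j : ℕ} (hij : (p.coeff j).coeff i ≠ 0) : i + j ≤ p.natDegree := by
  have lower : ∀ {r : k[X][X]}, r.Monic →
      homogenizer k r ≠ 0 ∧ r.natDegree ≤ (homogenizer k r).natDegree := by
    intro r hr
    have hne : (homogenizer k r).coeff r.natDegree ≠ 0 := by
      intro h0
      have := coeff_coeff_homogenizer r r.natDegree r.natDegree
      simp [h0, hr.coeff_natDegree] at this
    exact ⟨fun h0 => hne (by rw [h0, coeff_zero]), le_natDegree_of_ne_zero hne⟩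
  have upper : (homogenizer k (p * q)).natDegree ≤ p.natDegree + q.natDegree := by
    rw [natDegree_le_iff_coeff_eq_zero]
    intro m hm
    ext l
    rw [coeff_coeff_homogenizer, coeff_zero]
    split_ifs with hl
    · by_contra hne
      have := h _ _ hne
      omega
    · rfl
  rw [map_mul, natDegree_mul (lower hp).1 (lower hq).1] at upper
  have hpq := (lower hq).2
  have : i + j ≤ (homogenizer k p).natDegree := by
    apply le_natDegree_of_ne_zero
    intro h0
    have := coeff_coeff_homogenizer p (i + j) j
    rw [h0, coeff_zero, if_pos (by omega), Nat.add_sub_cancel] at this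
    exact hij this.symm
  omega

end WeightedDegree

end Polynomial

open Lagrange in
theorem Polynomial.eval_derivative_of_sub_C_eq_C_mul_nodal {S ι : Type*} [CommRing S]
    [DecidableEq ι] {p : S[X]} {s : Finset ι} {v : ι → S} {a c : S}
    (h : p - C a = C c * nodal s v) {i : ι} (hi : i ∈ s) :
    (derivative p).eval (v i) = c * ∏ j ∈ s.erase i, (v i - v j) := by
  have hd : derivative p = C c * derivative (nodal s v) := by
    rw [← derivative_C_mul, ← h, derivative_sub, derivative_C, sub_zero]
  rw [hd, eval_mul, eval_C, eval_nodal_derivative_eval_node_eq hi, eval_nodal]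

/-- A group `G` acting on a ring `R` and on a finite set `Ω` of elements of `R` (via `v`) behaves
like the monodromy group of the polynomial `f` acting on the roots of `f(X) - t`. -/
structure IsMonodromyModel {k R Ω : Type*} (G : Type*) [Field k] [CommRing R] [Algebra k R]
    [Group G] [MulSemiringAction G R] [Fintype Ω] [MulAction G Ω]
    (f : k[X]) (t : R) (v : Ω → R) : Prop where
  injective : Function.Injective v
  map_smul : ∀ (g : G) (x : Ω), v (g • x) = g • v x
  map_sub_C : f.map (algebraMap k R) - C t =
    C (algebraMap k R f.leadingCoeff) * Lagrange.nodal Finset.univ v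
  pretransitive : MulAction.IsPretransitive G Ω
  exists_aeval_eq : ∀ (x : Ω) (r : R), (∀ g : G, g • x = x → g • r = r) →
    ∃ p : k[X], aeval (v x) p = r
  transcendental : ∀ x, Transcendental k (v x)

namespace IsMonodromyModel

open Lagrange MulAction
open scoped Pointwise

variable {k R G Ω : Type*} [Field k] [CommRing R] [IsDomain R] [Algebra k R]
  [Group G] [MulSemiringAction G R] [SMulCommClass G k R] [Fintype Ω] [MulAction G Ω]
  {f : k[X]} {t : R} {v : Ω → R}

omit [IsDomain R] [SMulCommClass G k R] in
theorem aeval_injective (M : IsMonodromyModel G f t v) (x : Ω) :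
    Function.Injective (aeval (v x) : k[X] → R) :=
  transcendental_iff_injective.mp (M.transcendental x)

omit [IsDomain R] [SMulCommClass G k R] in
theorem aeval_eq (M : IsMonodromyModel G f t v) (x : Ω) : aeval (v x) f = t := by
  have := congrArg (eval (v x)) M.map_sub_C
  rwa [eval_mul, eval_nodal_at_node (Finset.mem_univ x), mul_zero, eval_sub, eval_C,
    eval_map_algebraMap, sub_eq_zero] at this

omit [IsDomain R] in
theorem smul_aeval (M : IsMonodromyModel G f t v) (g : G) (x : Ω) (p : k[X]) :
    g • aeval (v x) p = aeval (v (g • x)) p := by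
  rw [M.map_smul]
  exact (aeval_algHom_apply (MulSemiringAction.toAlgHom k R g) (v x) p).symm

omit [SMulCommClass G k R] in
theorem natDegree_eq_card (M : IsMonodromyModel G f t v) (hf : f ≠ 0) :
    f.natDegree = Fintype.card Ω := by
  have h := congrArg natDegree M.map_sub_C
  rwa [natDegree_sub_C, natDegree_map, natDegree_C_mul
    (by simpa using hf), natDegree_nodal, Finset.card_univ] at h

section Specialization

omit [IsDomain R] [SMulCommClass G k R] in
theorem sub_C_eq (M : IsMonodromyModel G f t v) (φ : R →ₐ[k] k) :
    f - C (φ t) = C f.leadingCoeff * nodal Finset.univ (fun x => φ (v x)) := by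
  have h := congrArg (Polynomial.map (φ : R →+* k)) M.map_sub_C
  have hφ : (φ : R →+* k).comp (algebraMap k R) = RingHom.id k := φ.comp_algebraMap
  simpa [nodal, Polynomial.map_map, hφ, Polynomial.map_prod] using h

omit [IsDomain R] [SMulCommClass G k R] in
theorem eval_map_eq (M : IsMonodromyModel G f t v) (φ : R →ₐ[k] k) (x : Ω) :
    f.eval (φ (v x)) = φ t := by
  rw [← M.aeval_eq x, ← aeval_algHom_apply, coe_aeval_eq_eval]

omit [IsDomain R] [SMulCommClass G k R] in
theorem eval_derivative_eq_zero_iff (M : IsMonodromyModel G f t v) (hf : f ≠ 0)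
    (φ : R →ₐ[k] k) (x : Ω) :
    (derivative f).eval (φ (v x)) = 0 ↔ ∃ y, y ≠ x ∧ φ (v y) = φ (v x) := by
  classical
  rw [eval_derivative_of_sub_C_eq_C_mul_nodal (v := fun x => φ (v x)) (M.sub_C_eq φ)
    (Finset.mem_univ x)]
  simp only [mul_eq_zero, leadingCoeff_eq_zero, hf, false_or, Finset.prod_eq_zero_iff,
    Finset.mem_erase, Finset.mem_univ, and_true, sub_eq_zero]
  exact exists_congr fun y => and_congr_right fun _ => eq_comm

/-- The ring `R` as an extension of the polynomial ring generated by `v x`. -/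
abbrev algebraAt (k : Type*) {R Ω : Type*} [Field k] [CommRing R] [Algebra k R] (v : Ω → R)
    (x : Ω) : Algebra k[X] R :=
  (aeval (v x) : k[X] →ₐ[k] R).toRingHom.toAlgebra

omit [IsDomain R] [SMulCommClass G k R] in
theorem isInvariant (M : IsMonodromyModel G f t v) (x : Ω) :
    let := algebraAt k v x
    Algebra.IsInvariant k[X] R (stabilizer G x) := by
  let := algebraAt k v x
  exact ⟨fun r hr => M.exists_aeval_eq x r fun g hg => hr ⟨g, hg⟩⟩

omit [IsDomain R] [SMulCommClass G k R] in
theorem exists_algHom_eq [Finite G] [IsAlgClosed k] (M : IsMonodromyModel G f t v) (x : Ω) (a : k) :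
    ∃ φ : R →ₐ[k] k, φ (v x) = a := by
  let := algebraAt k v x
  have := M.isInvariant x
  have : Algebra.IsIntegral k[X] R := Algebra.IsInvariant.isIntegral k[X] R (stabilizer G x)
  have hmax : (RingHom.ker (evalRingHom a)).IsMaximal :=
    RingHom.ker_isMaximal_of_surjective _ fun b => ⟨C b, by simp⟩
  obtain ⟨Q, hQ, hQP⟩ := Ideal.exists_ideal_over_maximal_of_isIntegral (S := R)
    (RingHom.ker (evalRingHom a)) (by
      intro p hp
      have : p = 0 := M.aeval_injective x (by rw [map_zero]; exact hp)
      simp [this])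
  have hx : v x - algebraMap k R a ∈ Q := by
    have : (X - C a : k[X]) ∈ Ideal.comap (algebraMap k[X] R) Q := by
      rw [hQP]; simp
    have h2 : algebraMap k[X] R (X - C a) ∈ Q := this
    have h3 : algebraMap k[X] R (X - C a) = aeval (v x) (X - C a : k[X]) := rfl
    rwa [h3, map_sub, aeval_X, aeval_C] at h2
  have hint : Algebra.IsIntegral k (R ⧸ Q) := by
    refine ⟨fun r => ?_⟩
    obtain ⟨r, rfl⟩ := Ideal.Quotient.mk_surjective r
    obtain ⟨p, hp, hpr⟩ := Algebra.IsIntegral.isIntegral (R := k[X]) r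
    refine ⟨p.map (evalRingHom a), hp.map _, ?_⟩
    have hcomp : (algebraMap k (R ⧸ Q)).comp (evalRingHom a) =
        (Ideal.Quotient.mk Q).comp (algebraMap k[X] R) := by
      ext b
      · have : algebraMap k[X] R (C b) = algebraMap k R b := aeval_C (v x) b
        simp only [RingHom.comp_apply, this, coe_evalRingHom, eval_C]
        rfl
      · have : algebraMap k[X] R X = v x := aeval_X (v x)
        simp only [RingHom.comp_apply, this, coe_evalRingHom, eval_X]
        exact ((Ideal.Quotient.eq).mpr hx).symm
    rw [eval₂_map, hcomp, ← hom_eval₂, hpr, map_zero]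
  have hbij := IsAlgClosed.algebraMap_bijective_of_isIntegral (k := k) (K := R ⧸ Q)
  let e := AlgEquiv.ofBijective (Algebra.ofId k (R ⧸ Q)) hbij
  refine ⟨(e.symm : (R ⧸ Q) →ₐ[k] k).comp (Ideal.Quotient.mkₐ k Q), ?_⟩
  change e.symm (Ideal.Quotient.mk Q (v x)) = a
  rw [AlgEquiv.symm_apply_eq]
  exact (Ideal.Quotient.eq).mpr hx

omit [IsDomain R] in
/-- The decomposition group of a specialization acts transitively on the roots with a given
specialized value. -/
theorem exists_smul_eq [Finite G] (M : IsMonodromyModel G f t v) (φ : R →ₐ[k] k) {x y : Ω}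
    (h : φ (v x) = φ (v y)) : ∃ g : G, g • x = y ∧ ∀ r, φ (g • r) = φ r := by
  let := algebraAt k v x
  have := M.isInvariant x
  have hcomm : SMulCommClass (stabilizer G x) k[X] R := by
    refine ⟨fun g p r => ?_⟩
    rw [Algebra.smul_def, Algebra.smul_def, smul_mul']
    congr 1
    exact (M.smul_aeval g.1 x p).trans (by rw [g.2]; rfl)
  obtain ⟨τ, hτ⟩ := M.pretransitive.exists_smul_eq x y
  let ψ : R →ₐ[k] k := φ.comp (MulSemiringAction.toAlgHom k R τ)
  have hψ : ∀ r, ψ r = φ (τ • r) := fun _ => rfl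
  have hunder : (RingHom.ker φ).under k[X] = (RingHom.ker ψ).under k[X] := by
    ext p
    change φ (aeval (v x) p) = 0 ↔ ψ (aeval (v x) p) = 0
    rw [hψ, M.smul_aeval, hτ, ← aeval_algHom_apply, ← aeval_algHom_apply, h]
  have : (RingHom.ker φ).IsPrime := RingHom.ker_isPrime _
  have : (RingHom.ker ψ).IsPrime := RingHom.ker_isPrime _
  obtain ⟨σ, hσ⟩ := Algebra.IsInvariant.exists_smul_of_under_eq k[X] R (stabilizer G x)
    (RingHom.ker φ) (RingHom.ker ψ) hunder
  refine ⟨τ * σ.1, by rw [mul_smul, σ.2, hτ], fun r => ?_⟩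
  have hmem : r - algebraMap k R (φ r) ∈ RingHom.ker φ := by simp [RingHom.mem_ker]
  have h2 : σ • (r - algebraMap k R (φ r)) ∈ RingHom.ker ψ := by
    rw [hσ]; exact Ideal.smul_mem_pointwise_smul _ _ _ hmem
  have h3 : σ • (r - algebraMap k R (φ r)) = σ.1 • r - algebraMap k R (φ r) := by
    rw [smul_sub]
    congr 1
    exact smul_algebraMap σ.1 (φ r)
  rw [h3, RingHom.mem_ker, map_sub, AlgHom.commutes, hψ, sub_eq_zero] at h2
  rw [mul_smul, h2]; rfl

end Specialization
end IsMonodromyModel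

theorem Lagrange.nodal_dvd_of_isRoot {S ι : Type*} [CommRing S] [IsDomain S] {s : Finset ι}
    {v : ι → S} (hv : Set.InjOn v s) {p : S[X]} (hp : ∀ i ∈ s, p.IsRoot (v i)) :
    nodal s v ∣ p := by
  by_cases h0 : p = 0
  · simp [h0]
  have h : nodal s v = ((s.val.map v).map fun a => X - C a).prod := by
    rw [Multiset.map_map]; rfl
  rw [h, Multiset.prod_X_sub_C_dvd_iff_le_roots h0,
    Multiset.le_iff_subset (Multiset.Nodup.map_on hv s.nodup)]
  intro a ha
  obtain ⟨i, hi, rfl⟩ := Multiset.mem_map.mp ha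
  exact (mem_roots h0).mpr (hp i hi)

namespace IsMonodromyModel

open Lagrange MulAction
open scoped Pointwise

variable {k R G Ω : Type*} [Field k] [CommRing R] [IsDomain R] [Algebra k R]
  [Group G] [MulSemiringAction G R] [SMulCommClass G k R] [Fintype Ω] [MulAction G Ω]
  {f : k[X]} {t : R} {v : Ω → R}

section Fiber

variable {h : k[X]} {s : Finset Ω} {a : R}

omit [SMulCommClass G k R] in
theorem nodal_dvd_map_sub_C (M : IsMonodromyModel G f t v)
    (hs : ∀ z ∈ s, aeval (v z) h = a) :
    nodal s v ∣ h.map (algebraMap k R) - C a :=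
  nodal_dvd_of_isRoot M.injective.injOn fun z hz => by
    rw [IsRoot, eval_sub, eval_C, eval_map_algebraMap, hs z hz, sub_self]

omit [SMulCommClass G k R] in
theorem card_le_natDegree (M : IsMonodromyModel G f t v) (hh : h.natDegree ≠ 0)
    (hs : ∀ z ∈ s, aeval (v z) h = a) : s.card ≤ h.natDegree := by
  have hd : (h.map (algebraMap k R) - C a).natDegree = h.natDegree := by
    rw [natDegree_sub_C, natDegree_map]
  rw [← hd, ← natDegree_nodal (s := s) (v := v)]
  exact natDegree_le_of_dvd (M.nodal_dvd_map_sub_C hs) (ne_zero_of_natDegree_gt (n := 0) (by omega))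

omit [SMulCommClass G k R] in
theorem map_sub_C_eq_of_card_eq (M : IsMonodromyModel G f t v) (hh : h.natDegree ≠ 0)
    (hs : ∀ z ∈ s, aeval (v z) h = a) (hcard : s.card = h.natDegree) :
    h.map (algebraMap k R) - C a = C (algebraMap k R h.leadingCoeff) * nodal s v := by
  have hd : (h.map (algebraMap k R) - C a).natDegree = h.natDegree := by
    rw [natDegree_sub_C, natDegree_map]
  rw [eq_leadingCoeff_mul_of_monic_of_dvd_of_natDegree_le (nodal_monic (s := s) (v := v))
    (M.nodal_dvd_map_sub_C hs) (by rw [hd, natDegree_nodal, hcard])]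
  rw [leadingCoeff, hd, coeff_sub, coeff_C, if_neg hh, sub_zero, coeff_map, leadingCoeff]

omit [SMulCommClass G k R] in
theorem sub_C_eq_of_card_eq (M : IsMonodromyModel G f t v) (hh : h.natDegree ≠ 0)
    (hs : ∀ z ∈ s, aeval (v z) h = a) (hcard : s.card = h.natDegree) (φ : R →ₐ[k] k) :
    h - C (φ a) = C h.leadingCoeff * nodal s (fun x => φ (v x)) := by
  have h := congrArg (Polynomial.map (φ : R →+* k)) (M.map_sub_C_eq_of_card_eq hh hs hcard)
  have hφ : (φ : R →+* k).comp (algebraMap k R) = RingHom.id k := φ.comp_algebraMap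
  simpa [nodal, Polynomial.map_map, hφ, Polynomial.map_prod] using h

open Classical in
/-- The fiber through `y` of the map `z ↦ h(v z)`. -/
def fiber (v : Ω → R) (h : k[X]) (y : Ω) : Finset Ω :=
  Finset.univ.filter fun z => aeval (v z) h = aeval (v y) h

omit [IsDomain R] in
theorem mem_fiber {y z : Ω} : z ∈ fiber v h y ↔ aeval (v z) h = aeval (v y) h := by
  simp [fiber]

omit [IsDomain R] in
theorem smul_mem_fiber_iff (M : IsMonodromyModel G f t v) (g : G) {y z : Ω} :
    g • z ∈ fiber v h (g • y) ↔ z ∈ fiber v h y := by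
  rw [mem_fiber, mem_fiber, ← M.smul_aeval, ← M.smul_aeval, smul_left_cancel_iff]

omit [IsDomain R] in
theorem exists_aeval_eq_prod_notMem_fiber [DecidableEq Ω] (M : IsMonodromyModel G f t v)
    (h : k[X]) (x : Ω) :
    ∃ w : k[X], aeval (v x) w = ∏ z ∈ (fiber v h x)ᶜ, (v x - v z) := by
  refine M.exists_aeval_eq x _ fun g hg => ?_
  rw [Finset.smul_prod']
  refine Finset.prod_bij (fun z _ => g • z) ?_ (fun _ _ _ _ => smul_left_cancel g) ?_ ?_
  · intro z hz
    rw [Finset.mem_compl] at hz ⊢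
    rwa [← M.smul_mem_fiber_iff g, hg] at hz
  · intro z hz
    refine ⟨g⁻¹ • z, ?_, smul_inv_smul g z⟩
    rw [Finset.mem_compl] at hz ⊢
    rwa [← M.smul_mem_fiber_iff g, hg, smul_inv_smul]
  · intro z _
    rw [smul_sub, ← M.map_smul, ← M.map_smul, hg]

/-- A polynomial all of whose fibers are as large as possible is a left factor of `f`; its
derivative divides that of `f`. -/
theorem exists_derivative_eq_mul [DecidableEq Ω] (M : IsMonodromyModel G f t v)
    (hh : h.natDegree ≠ 0) (x : Ω) (hcard : (fiber v h x).card = h.natDegree) :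
    ∃ w : k[X], aeval (v x) w = ∏ z ∈ (fiber v h x)ᶜ, (v x - v z) ∧
      C h.leadingCoeff * derivative f = C f.leadingCoeff * derivative h * w := by
  obtain ⟨w, hw⟩ := M.exists_aeval_eq_prod_notMem_fiber h x
  refine ⟨w, hw, M.aeval_injective x ?_⟩
  have hF := eval_derivative_of_sub_C_eq_C_mul_nodal M.map_sub_C (Finset.mem_univ x)
  have hx : x ∈ fiber v h x := mem_fiber.mpr rfl
  have hH := eval_derivative_of_sub_C_eq_C_mul_nodal
    (M.map_sub_C_eq_of_card_eq hh (s := fiber v h x) (fun z hz => mem_fiber.mp hz) hcard) hx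
  rw [derivative_map, eval_map_algebraMap] at hF hH
  have hsplit : ∏ z ∈ Finset.univ.erase x, (v x - v z) =
      (∏ z ∈ (fiber v h x).erase x, (v x - v z)) * ∏ z ∈ (fiber v h x)ᶜ, (v x - v z) := by
    rw [← Finset.prod_union]
    · congr 1
      ext z
      by_cases hz : z = x <;> simp [hz, hx, em]
    · rw [Finset.disjoint_left]
      intro z hz hz'
      exact Finset.mem_compl.mp hz' (Finset.mem_of_mem_erase hz)
  simp only [map_mul, aeval_C, hF, hH, hw, hsplit]
  ring

theorem exists_map_eq_and_notMem_fiber [Finite G] [IsAlgClosed k] (M : IsMonodromyModel G f t v)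
    (hn : (f.natDegree : k) ≠ 0) (hh : h.natDegree ≠ 0) (hlt : h.natDegree < f.natDegree) (x : Ω)
    (hcard : (fiber v h x).card = h.natDegree) :
    ∃ (φ : R →ₐ[k] k) (y : Ω), φ (v x) = φ (v y) ∧ y ∉ fiber v h x := by
  classical
  obtain ⟨w, hw, hfh⟩ := M.exists_derivative_eq_mul hh x hcard
  have hlc : h.leadingCoeff ≠ 0 := leadingCoeff_ne_zero.mpr (by rintro rfl; simp at hh)
  have hflc : f.leadingCoeff ≠ 0 := leadingCoeff_ne_zero.mpr (by rintro rfl; simp at hn)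
  have hdeg : w.degree ≠ 0 := by
    intro h0
    rw [eq_C_of_degree_eq_zero h0] at hfh
    have := congrArg (fun p => p.coeff (f.natDegree - 1)) hfh
    have hsucc : f.natDegree - 1 + 1 = f.natDegree := by omega
    simp only [coeff_C_mul, coeff_mul_C, coeff_derivative, hsucc,
      coeff_eq_zero_of_natDegree_lt hlt, coeff_natDegree] at this
    have hcast : ((f.natDegree - 1 : ℕ) : k) + 1 = f.natDegree := by
      rw [← hsucc]; push_cast; simp
    rw [hcast] at this
    simp [hlc, hflc, hn] at this
  obtain ⟨a, ha⟩ := IsAlgClosed.exists_root w hdeg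
  obtain ⟨φ, hφ⟩ := M.exists_algHom_eq x a
  have := congrArg φ hw
  rw [← aeval_algHom_apply, hφ, coe_aeval_eq_eval, ha, map_prod, eq_comm,
    Finset.prod_eq_zero_iff] at this
  obtain ⟨y, hy, hxy⟩ := this
  rw [map_sub, sub_eq_zero] at hxy
  exact ⟨φ, y, hxy, Finset.mem_compl.mp hy⟩

omit [SMulCommClass G k R] in
/-- Under the assumption of distinct critical values, two roots in distinct fibers which meet under
a specialization force the whole fiber to collapse. -/
theorem sub_C_eq_C_mul_pow (M : IsMonodromyModel G f t v) (hf : f ≠ 0)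
    (hdist : ∀ α β : k, (derivative f).eval α = 0 → (derivative f).eval β = 0 →
      f.eval α = f.eval β → α = β)
    (hh : h.natDegree ≠ 0) (hcard : ∀ y, (fiber v h y).card = h.natDegree) (φ : R →ₐ[k] k)
    {y z : Ω} (hyz : φ (v y) = φ (v z)) (hne : z ∉ fiber v h y) :
    h - C (φ (aeval (v y) h)) = C h.leadingCoeff * (X - C (φ (v y))) ^ h.natDegree := by
  have hlc : h.leadingCoeff ≠ 0 := leadingCoeff_ne_zero.mpr (by rintro rfl; simp at hh)
  have hy := M.sub_C_eq_of_card_eq hh (s := fiber v h y) (fun z hz => mem_fiber.mp hz) (hcard y) φ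
  have hz := M.sub_C_eq_of_card_eq hh (s := fiber v h z) (fun z hz => mem_fiber.mp hz) (hcard z) φ
  have hφ : φ (aeval (v y) h) = φ (aeval (v z) h) := by
    rw [← aeval_algHom_apply, ← aeval_algHom_apply, hyz]
  have hcollapse : ∀ w ∈ fiber v h y, φ (v w) = φ (v y) := by
    intro w hw
    have h0 := congrArg (eval (φ (v w))) (hy.symm.trans (by rw [hφ, hz]))
    rw [eval_mul, eval_mul, eval_nodal_at_node (v := fun x => φ (v x)) hw, mul_zero, eq_comm,
      mul_eq_zero, eval_C, or_iff_right hlc, eval_nodal, Finset.prod_eq_zero_iff] at h0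
    obtain ⟨w', hw', hww'⟩ := h0
    refine hdist _ _
      ((M.eval_derivative_eq_zero_iff hf φ w).mpr ⟨w', ?_, (sub_eq_zero.mp hww').symm⟩)
      ((M.eval_derivative_eq_zero_iff hf φ y).mpr ⟨z, ?_, hyz.symm⟩)
      (by rw [M.eval_map_eq, M.eval_map_eq])
    · rintro rfl
      rw [mem_fiber] at hw hw' hne
      exact hne (hw'.symm.trans hw)
    · rintro rfl
      exact hne (mem_fiber.mpr rfl)
  rw [hy, nodal, Finset.prod_congr rfl fun w hw => by rw [hcollapse w hw], Finset.prod_const,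
    hcard]

theorem false_of_card_fiber_eq [Finite G] [IsAlgClosed k] [Nonempty Ω]
    (M : IsMonodromyModel G f t v)
    (hn : (f.natDegree : k) ≠ 0)
    (hcrit : ∃ α β : k, α ≠ β ∧ (derivative f).eval α = 0 ∧ (derivative f).eval β = 0)
    (hdist : ∀ α β : k, (derivative f).eval α = 0 → (derivative f).eval β = 0 →
      f.eval α = f.eval β → α = β)
    (h1 : 1 < h.natDegree) (hhk : (h.natDegree : k) ≠ 0) (hlt : h.natDegree < f.natDegree)
    (hcard : ∀ y, (fiber v h y).card = h.natDegree) : False := by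
  classical
  have hh : h.natDegree ≠ 0 := by omega
  have hf : f ≠ 0 := by rintro rfl; simp at hn
  have hlc : h.leadingCoeff ≠ 0 := leadingCoeff_ne_zero.mpr (by rintro rfl; simp at hh)
  obtain ⟨x⟩ := ‹Nonempty Ω›
  obtain ⟨φ, y, hxy, hy⟩ := M.exists_map_eq_and_notMem_fiber hn hh hlt x (hcard x)
  have hpow : ∀ (ψ : R →ₐ[k] k) (y z : Ω), ψ (v y) = ψ (v z) → z ∉ fiber v h y →
      derivative h = C h.leadingCoeff * (C (h.natDegree : k) *
        (X - C (ψ (v y))) ^ (h.natDegree - 1)) := by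
    intro ψ y z hyz hz
    have := congrArg derivative (M.sub_C_eq_C_mul_pow hf hdist hh hcard ψ hyz hz)
    rwa [derivative_sub, derivative_C, sub_zero, derivative_C_mul, derivative_X_sub_C_pow] at this
  have hroot : ∀ a, (derivative h).eval a = 0 → a = φ (v x) := by
    intro a ha
    rw [hpow φ x y hxy hy] at ha
    simp only [eval_mul, eval_C, eval_pow, eval_sub, eval_X, mul_eq_zero, hlc, hhk, false_or] at ha
    exact sub_eq_zero.mp (pow_eq_zero_iff (by omega) |>.mp ha)
  have hcritical : ∀ a, (derivative f).eval a = 0 → a = φ (v x) := by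
    intro a ha
    apply hroot
    obtain ⟨ψ, rfl⟩ := M.exists_algHom_eq x a
    obtain ⟨z, hzx, hz⟩ := (M.eval_derivative_eq_zero_iff hf ψ x).mp ha
    by_cases hzF : z ∈ fiber v h x
    · have hx : x ∈ fiber v h x := mem_fiber.mpr rfl
      have hF := M.sub_C_eq_of_card_eq hh (s := fiber v h x) (fun z hz => mem_fiber.mp hz)
        (hcard x) ψ
      rw [eval_derivative_of_sub_C_eq_C_mul_nodal (v := fun x => ψ (v x)) hF hx,
        Finset.prod_eq_zero (Finset.mem_erase.mpr ⟨hzx, hzF⟩) (by rw [hz, sub_self]), mul_zero]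
    · rw [hpow ψ x z hz.symm hzF]
      have : h.natDegree - 1 ≠ 0 := by omega
      simp [this]
  obtain ⟨α, β, hαβ, hα, hβ⟩ := hcrit
  exact hαβ ((hcritical α hα).trans (hcritical β hβ).symm)

end Fiber
end IsMonodromyModel

namespace IsMonodromyModel

open Lagrange MulAction
open scoped Pointwise

variable {k R G Ω : Type*} [Field k] [CommRing R] [IsDomain R] [Algebra k R]
  [Group G] [MulSemiringAction G R] [SMulCommClass G k R] [Fintype Ω] [MulAction G Ω]
  {f : k[X]} {t : R} {v : Ω → R}

omit [IsDomain R] [SMulCommClass G k R] in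
theorem map_toRingHom_nodal (M : IsMonodromyModel G f t v) {s : Finset Ω} {g : G}
    (hs : ∀ z, z ∈ s ↔ g • z ∈ s) :
    (nodal s v).map (MulSemiringAction.toRingHom G R g) = nodal s v := by
  rw [nodal, Polynomial.map_prod]
  refine Finset.prod_equiv (toPerm g) hs fun z _ => ?_
  simp [M.map_smul]

omit [IsDomain R] [SMulCommClass G k R] in
theorem smul_coeff_nodal (M : IsMonodromyModel G f t v) {s : Finset Ω} {g : G}
    (hs : ∀ z, z ∈ s ↔ g • z ∈ s) (j : ℕ) :
    g • (nodal s v).coeff j = (nodal s v).coeff j := by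
  conv_rhs => rw [← M.map_toRingHom_nodal hs, coeff_map]
  rfl

omit [SMulCommClass G k R] in
theorem exists_map_aeval_eq_nodal (M : IsMonodromyModel G f t v) {s : Finset Ω} {x : Ω}
    (hs : ∀ g : G, g • x = x → ∀ z, z ∈ s ↔ g • z ∈ s) :
    ∃ p : k[X][X], p.Monic ∧ p.natDegree = s.card ∧
      p.map (aeval (v x) : k[X] →ₐ[k] R).toRingHom = nodal s v := by
  have hl : nodal s v ∈ lifts (aeval (v x) : k[X] →ₐ[k] R).toRingHom :=
    (lifts_iff_coeff_lifts _).mpr fun j =>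
      M.exists_aeval_eq x _ fun g hg => M.smul_coeff_nodal (hs g hg) j
  obtain ⟨p, hp, hdeg, hmonic⟩ := lifts_and_natDegree_eq_and_monic hl nodal_monic
  exact ⟨p, hmonic, by rw [hdeg, natDegree_nodal], hp⟩

omit [SMulCommClass G k R] in
/-- Every invariant factor of `f(Y) - t` over the field generated by a root `v x` has total degree
equal to its degree in `Y`. -/
theorem exists_coeff_nodal_eq_aeval (M : IsMonodromyModel G f t v) (hf : f ≠ 0) {s : Finset Ω}
    {x : Ω} (hx : x ∈ s) (hs : ∀ g : G, g • x = x → ∀ z, z ∈ s ↔ g • z ∈ s) :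
    ∃ (h : k[X]) (j : ℕ), (nodal s v).coeff j = aeval (v x) h ∧ h.natDegree ≠ 0 ∧
      h.natDegree ≤ s.card := by
  classical
  obtain ⟨p, hp, hpdeg, hpmap⟩ := M.exists_map_aeval_eq_nodal hs
  obtain ⟨q, hq, hqdeg, hqmap⟩ := M.exists_map_aeval_eq_nodal (s := sᶜ) (x := x) fun g hg z => by
    rw [Finset.mem_compl, Finset.mem_compl, hs g hg]
  have hinj : Function.Injective (aeval (v x) : k[X] →ₐ[k] R).toRingHom := M.aeval_injective x
  have hcomp : (aeval (v x) : k[X] →ₐ[k] R).toRingHom.comp C = algebraMap k R :=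
    RingHom.ext fun a => aeval_C (v x) a
  have hpq : C (C f.leadingCoeff) * (p * q) = f.map C - C f := by
    apply map_injective _ hinj
    have hC : (aeval (v x) : k[X] →ₐ[k] R).toRingHom (C f.leadingCoeff) =
      algebraMap k R f.leadingCoeff := aeval_C _ _
    have hft : (aeval (v x) : k[X] →ₐ[k] R).toRingHom f = t := M.aeval_eq x
    rw [Polynomial.map_mul, Polynomial.map_mul, hpmap, hqmap, map_C, Polynomial.map_sub,
      Polynomial.map_map, hcomp, map_C, hC, hft, M.map_sub_C, nodal, nodal, nodal,
      Finset.prod_mul_prod_compl]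
  have htotal : ∀ i j, ((p * q).coeff j).coeff i ≠ 0 → i + j ≤ p.natDegree + q.natDegree := by
    intro i j hij
    have hcoeff : ((f.map C - C f).coeff j).coeff i ≠ 0 := by
      rw [← hpq, coeff_C_mul, coeff_C_mul]
      exact mul_ne_zero (leadingCoeff_ne_zero.mpr hf) hij
    rw [hpdeg, hqdeg, Finset.card_add_card_compl, ← M.natDegree_eq_card hf]
    by_contra! hlt
    apply hcoeff
    rw [coeff_sub, coeff_map, coeff_sub, coeff_C, coeff_C]
    have h0 : ∀ m, f.natDegree < m → f.coeff m = 0 := fun m => coeff_eq_zero_of_natDegree_lt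
    split_ifs with hi hj hj
    · omega
    · simp [h0 j (by omega)]
    · simp [h0 i (by omega)]
    · simp
  obtain ⟨j, hj⟩ : ∃ j, (p.coeff j).natDegree ≠ 0 := by
    by_contra! hconst
    obtain ⟨r, rfl⟩ : ∃ r, mapRingHom C r = p := (lifts_iff_coeff_lifts p).mpr fun j =>
      ⟨_, (eq_C_of_natDegree_eq_zero (hconst j)).symm⟩
    rw [coe_mapRingHom] at hp hpmap
    rw [Polynomial.map_map, hcomp] at hpmap
    have hr : aeval (v x) r = 0 := by
      rw [← eval_map_algebraMap, hpmap, eval_nodal_at_node hx]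
    rw [(map_eq_zero_iff _ (M.aeval_injective x)).mp hr, Polynomial.map_zero] at hp
    exact not_monic_zero hp
  refine ⟨p.coeff j, j, ?_, hj, ?_⟩
  · rw [← hpmap, coeff_map]; rfl
  · have := add_le_natDegree_of_monic_mul hp hq htotal (i := (p.coeff j).natDegree) (j := j) (by
      rw [coeff_natDegree, Ne, leadingCoeff_eq_zero]
      intro h0
      simp [h0] at hj)
    omega

theorem isPreprimitive [Finite G] [IsAlgClosed k] [Nonempty Ω] (M : IsMonodromyModel G f t v)
    (hn : (f.natDegree : k) ≠ 0)
    (hcrit : ∃ α β : k, α ≠ β ∧ (derivative f).eval α = 0 ∧ (derivative f).eval β = 0)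
    (hdist : ∀ α β : k, (derivative f).eval α = 0 → (derivative f).eval β = 0 →
      f.eval α = f.eval β → α = β) : IsPreprimitive G Ω := by
  classical
  have hf : f ≠ 0 := by rintro rfl; simp at hn
  have := M.pretransitive
  obtain ⟨x⟩ := ‹Nonempty Ω›
  refine IsPreprimitive.of_isTrivialBlock_base x fun {B} hx hB => ?_
  have hmem : ∀ g : G, g • x ∈ B → ∀ z, z ∈ B.toFinset ↔ g • z ∈ B.toFinset := by
    intro g hg z
    have := hB.smul_eq_of_mem hx hg
    rw [Set.mem_toFinset, Set.mem_toFinset]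
    conv_rhs => rw [← this, Set.smul_mem_smul_set_iff]
  obtain ⟨h, j, hj, hh, hle⟩ := M.exists_coeff_nodal_eq_aeval hf (s := B.toFinset)
    (Set.mem_toFinset.mpr hx) fun g hg => hmem g (by rwa [hg])
  have hsub : B.toFinset ⊆ fiber v h x := by
    intro y hy
    obtain ⟨g, rfl⟩ := MulAction.exists_smul_eq G x y
    rw [mem_fiber, ← M.smul_aeval, ← hj, M.smul_coeff_nodal (hmem g (Set.mem_toFinset.mp hy))]
  have hfiber := M.card_le_natDegree hh (s := fiber v h x) fun z hz => mem_fiber.mp hz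
  have hBcard := Finset.card_le_card hsub
  have hcard : ∀ y, (fiber v h y).card = h.natDegree := by
    intro y
    obtain ⟨g, rfl⟩ := MulAction.exists_smul_eq G x y
    rw [← Finset.card_equiv (toPerm g) (s := fiber v h x) fun z => (M.smul_mem_fiber_iff g).symm]
    omega
  have hdvd := hB.ncard_dvd_card ⟨x, hx⟩
  rw [Set.ncard_eq_toFinset_card', show B.toFinset.card = h.natDegree by omega,
    Nat.card_eq_fintype_card, ← M.natDegree_eq_card hf] at hdvd
  have hhk : (h.natDegree : k) ≠ 0 := by
    obtain ⟨m, hm⟩ := hdvd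
    rw [hm, Nat.cast_mul] at hn
    exact left_ne_zero_of_mul hn
  have hfpos : 0 < f.natDegree := Nat.pos_of_ne_zero (by rintro h0; simp [h0] at hn)
  rcases (Nat.le_of_dvd hfpos hdvd).lt_or_eq with hlt | heq
  · have : Nonempty Ω := ⟨x⟩
    left
    by_contra hsubs
    refine M.false_of_card_fiber_eq hn hcrit hdist ?_ hhk hlt hcard
    have : 1 < B.toFinset.card := by
      rw [Set.not_subsingleton_iff] at hsubs
      obtain ⟨a, ha, b, hb, hab⟩ := hsubs
      exact Finset.one_lt_card.mpr ⟨a, by simpa, b, by simpa, hab⟩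
    omega
  · right
    rw [M.natDegree_eq_card hf] at heq
    have : B.toFinset = Finset.univ := (Finset.card_eq_iff_eq_univ _).mp (by omega)
    simpa using this

theorem isMultiplyPretransitive [Finite G] [IsAlgClosed k] [Nonempty Ω]
    (M : IsMonodromyModel G f t v) (hn : (f.natDegree : k) ≠ 0)
    (hcrit : ∃ α β : k, α ≠ β ∧ (derivative f).eval α = 0 ∧ (derivative f).eval β = 0)
    (hdist : ∀ α β : k, (derivative f).eval α = 0 → (derivative f).eval β = 0 →
      f.eval α = f.eval β → α = β) : IsMultiplyPretransitive G Ω 2 := by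
  classical
  have hf : f ≠ 0 := by rintro rfl; simp at hn
  have hprim := M.isPreprimitive hn hcrit hdist
  obtain ⟨α, β, hαβ, hα, hβ⟩ := hcrit
  obtain ⟨x⟩ := ‹Nonempty Ω›
  obtain ⟨φ, rfl⟩ := M.exists_algHom_eq x α
  obtain ⟨y, hyx, hy⟩ := (M.eval_derivative_eq_zero_iff hf φ x).mp hα
  let Γ : Set Ω := {z | φ (v z) = φ (v x)}
  have hproper : Γ ≠ Set.univ := by
    intro hΓ
    have hall : ∀ z, φ (v z) = φ (v x) := fun z => hΓ.ge (Set.mem_univ z)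
    have hpow := congrArg derivative (M.sub_C_eq φ)
    simp only [nodal, hall, Finset.prod_const, derivative_sub, derivative_C, sub_zero,
      derivative_C_mul, derivative_X_sub_C_pow, Finset.card_univ, ← M.natDegree_eq_card hf] at hpow
    rw [hpow] at hβ
    simp only [eval_mul, eval_C, eval_pow, eval_sub, eval_X, mul_eq_zero, hn,
      leadingCoeff_eq_zero, hf, false_or] at hβ
    exact hαβ (sub_eq_zero.mp (eq_zero_of_pow_eq_zero hβ)).symm
  have hpos : 0 < Γᶜ.ncard := by
    rw [Set.ncard_pos]
    exact Set.nonempty_compl.mpr hproper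
  have htwo : 1 < Γ.ncard := (Set.one_lt_ncard).mpr ⟨x, rfl, y, hy, hyx.symm⟩
  have hadd := Set.ncard_add_ncard_compl Γ
  refine hprim.is_two_pretransitive (s := Γᶜ) (n := Γᶜ.ncard - 1) (by omega) (by omega) ?_
  refine ⟨fun ⟨a, ha⟩ ⟨b, hb⟩ => ?_⟩
  rw [SubMulAction.mem_ofFixingSubgroup_iff, Set.notMem_compl_iff] at ha hb
  obtain ⟨g, hg, hgφ⟩ := M.exists_smul_eq φ (ha.trans hb.symm)
  have hfix : g ∈ fixingSubgroup G Γᶜ := by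
    rw [mem_fixingSubgroup_iff]
    intro z hz
    by_contra hgz
    apply hz
    refine hdist _ _ ((M.eval_derivative_eq_zero_iff hf φ z).mpr ⟨g • z, hgz, ?_⟩) hα
      (by rw [M.eval_map_eq, M.eval_map_eq])
    rw [M.map_smul, hgφ]
  exact ⟨⟨g, hfix⟩, Subtype.ext hg⟩

end IsMonodromyModel

section MonodromyPoly

variable {k : Type*} [Field k] {f : k[X]}

theorem monodromyPoly_eq_map (f : k[X]) :
    monodromyPoly k f = (f.map C - C X).map (algebraMap k[X] (RatFunc k)) := by
  rw [monodromyPoly, Polynomial.map_sub, Polynomial.map_map, map_C, RatFunc.algebraMap_X]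
  rfl

theorem natDegree_monodromyPoly (f : k[X]) : (monodromyPoly k f).natDegree = f.natDegree := by
  rw [monodromyPoly, natDegree_sub_C, natDegree_map]

theorem irreducible_monodromyPoly (hf : f.natDegree ≠ 0) : Irreducible (monodromyPoly k f) := by
  have hirr : Irreducible (f.map C - C X : k[X][X]) := by
    have h : Bivariate.swap (R := k) (f.map C - C X) = -(X - C f) := by
      rw [map_sub, Bivariate.swap_map_C, Bivariate.swap_C, map_X, neg_sub]
    rw [← MulEquiv.irreducible_iff (Bivariate.swap (R := k)), h]
    exact (Associated.refl (X - C f)).neg_right.irreducible (irreducible_X_sub_C f)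
  rw [monodromyPoly_eq_map]
  refine (IsPrimitive.irreducible_iff_irreducible_map_fraction_map (hirr.isPrimitive ?_)).mp hirr
  rwa [natDegree_sub_C, natDegree_map]

theorem separable_monodromyPoly (hf : derivative f ≠ 0) : (monodromyPoly k f).Separable := by
  have hdeg : f.natDegree ≠ 0 := fun h => hf (derivative_of_natDegree_zero h)
  rw [separable_iff_derivative_ne_zero (irreducible_monodromyPoly hdeg), monodromyPoly,
    derivative_sub, derivative_C, sub_zero, derivative_map]
  exact (Polynomial.map_ne_zero_iff (algebraMap k (RatFunc k)).injective).mpr hf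

section SplittingField

variable {L : Type*} [Field L] [Algebra (RatFunc k) L] [Algebra k[X] L] [Algebra k L]
  [IsScalarTower k[X] (RatFunc k) L] [IsScalarTower k (RatFunc k) L] [IsScalarTower k k[X] L]

omit [IsScalarTower k k[X] L] in
theorem aeval_eq_of_mem_rootSet {x : L} (hx : x ∈ (monodromyPoly k f).rootSet L) :
    aeval x f = algebraMap k[X] L X := by
  have h := aeval_eq_zero_of_mem_rootSet hx
  rw [monodromyPoly, map_sub, aeval_C, aeval_map_algebraMap, sub_eq_zero] at h
  rw [h, IsScalarTower.algebraMap_apply k[X] (RatFunc k) L, RatFunc.algebraMap_X]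

theorem aeval_comp_eq_of_mem_rootSet {x : L} (hx : x ∈ (monodromyPoly k f).rootSet L) (p : k[X]) :
    aeval x (p.comp f) = algebraMap k[X] L p := by
  rw [aeval_comp, aeval_eq_of_mem_rootSet hx, aeval_algebraMap_apply, aeval_X_left_apply]

theorem transcendental_of_mem_rootSet {x : L} (hx : x ∈ (monodromyPoly k f).rootSet L) :
    Transcendental k x := by
  refine (transcendental_aeval_iff (f := f)).mp ?_ |>.1
  rw [aeval_eq_of_mem_rootSet hx, transcendental_algebraMap_iff]
  · exact transcendental_X k
  · rw [IsScalarTower.algebraMap_eq k[X] (RatFunc k) L]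
    exact (algebraMap (RatFunc k) L).injective.comp (RatFunc.algebraMap_injective k)

theorem isIntegral_of_mem_rootSet (hf : f.natDegree ≠ 0) {x : L}
    (hx : x ∈ (monodromyPoly k f).rootSet L) : IsIntegral k[X] x := by
  have hlc : f.leadingCoeff ≠ 0 := leadingCoeff_ne_zero.mpr (by rintro rfl; simp at hf)
  refine ⟨C (C f.leadingCoeff⁻¹) * (f.map C - C X),
    monic_C_mul_of_mul_leadingCoeff_eq_one ?_, ?_⟩
  · have hlead : (f.map C - C X : k[X][X]).leadingCoeff = C f.leadingCoeff := by
      rw [leadingCoeff, natDegree_sub_C, natDegree_map, coeff_sub, coeff_map, coeff_C, if_neg hf,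
        sub_zero, leadingCoeff]
    rw [hlead, ← C_mul, inv_mul_cancel₀ hlc, C_1]
  · have hcomp : (algebraMap k[X] L).comp C = algebraMap k L :=
      (IsScalarTower.algebraMap_eq k k[X] L).symm
    rw [eval₂_mul, eval₂_sub, eval₂_map, hcomp, eval₂_C, eval₂_C, ← aeval_def,
      aeval_eq_of_mem_rootSet hx, sub_self, mul_zero]

/-- An element of `k(x)` which is integral over `k[f(x)]` is a polynomial in `x`. -/
theorem exists_aeval_eq_of_isIntegral {x : L}
    (hx : x ∈ (monodromyPoly k f).rootSet L) {r : L} (hr : r ∈ IntermediateField.adjoin k {x})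
    (hint : IsIntegral k[X] r) : ∃ p : k[X], aeval x p = r := by
  let e := RatFunc.algEquivOfTranscendental x (transcendental_of_mem_rootSet hx)
  let φ : RatFunc k →ₐ[k] L := (IntermediateField.val _).comp e.toAlgHom
  have hφ : ∀ p : k[X], φ (algebraMap k[X] (RatFunc k) p) = aeval x p := by
    intro p
    change ((e (algebraMap k[X] (RatFunc k) p) : _) : L) = _
    rw [RatFunc.algEquivOfTranscendental_algebraMap]
    exact IntermediateField.aeval_coe _ (IntermediateField.AdjoinSimple.gen k x) p |>.symm
  obtain ⟨u, hu⟩ : ∃ u, φ u = r := ⟨e.symm ⟨r, hr⟩, by simp [φ]⟩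
  obtain ⟨p, hp, hpr⟩ := hint
  have huint : IsIntegral k[X] u := by
    refine ⟨p.map (compRingHom f), hp.map _, φ.toRingHom.injective ?_⟩
    have hcomp : (φ.toRingHom.comp (algebraMap k[X] (RatFunc k))).comp (compRingHom f) =
        algebraMap k[X] L :=
      RingHom.ext fun q => (hφ _).trans (aeval_comp_eq_of_mem_rootSet hx q)
    rw [hom_eval₂, eval₂_map, hcomp, map_zero]
    exact hu ▸ hpr
  obtain ⟨q, hq⟩ := IsIntegrallyClosed.isIntegral_iff.mp huint
  exact ⟨q, by rw [← hφ, hq, hu]⟩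

theorem mem_adjoin_of_mem_adjoin_ratFunc {x : L} (hx : x ∈ (monodromyPoly k f).rootSet L) {r : L}
    (hr : r ∈ IntermediateField.adjoin (RatFunc k) {x}) :
    r ∈ IntermediateField.adjoin k {x} := by
  have haeval : ∀ p : k[X], algebraMap k[X] L p ∈ IntermediateField.adjoin k {x} := fun p => by
    rw [← aeval_comp_eq_of_mem_rootSet hx p]
    exact IntermediateField.algebra_adjoin_le_adjoin k {x} (aeval_mem_adjoin_singleton k x)
  induction hr using IntermediateField.adjoin_induction with
  | mem y hy => exact IntermediateField.subset_adjoin k {x} hy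
  | algebraMap u =>
    rw [← RatFunc.num_div_denom u, map_div₀, ← IsScalarTower.algebraMap_apply,
      ← IsScalarTower.algebraMap_apply]
    exact div_mem (haeval _) (haeval _)
  | add y z _ _ hy hz => exact add_mem hy hz
  | inv y _ hy => exact inv_mem hy
  | mul y z _ _ hy hz => exact mul_mem hy hz

/-- The roots of `f(X) - t` as elements of the integral closure of `k[t]`. -/
def integralRoot (hf : f.natDegree ≠ 0) (x : (monodromyPoly k f).rootSet L) :
    integralClosure k[X] L :=
  ⟨x, isIntegral_of_mem_rootSet hf x.2⟩

instance smulCommClass_integralClosure :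
    SMulCommClass (L ≃ₐ[RatFunc k] L) k (integralClosure k[X] L) :=
  ⟨fun g a r => Subtype.ext (smul_comm g a (r : L))⟩

theorem isMonodromyModel_integralRoot [IsSplittingField (RatFunc k) L (monodromyPoly k f)]
    (hf : derivative f ≠ 0) (hdeg : f.natDegree ≠ 0) :
    IsMonodromyModel (L ≃ₐ[RatFunc k] L) f (algebraMap k[X] (integralClosure k[X] L) X)
      (integralRoot (L := L) hdeg) := by
  have hsep := separable_monodromyPoly hf
  have hirr := irreducible_monodromyPoly hdeg
  have hsplits := IsSplittingField.splits L (monodromyPoly k f)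
  have hgal : IsGalois (RatFunc k) L := IsGalois.of_separable_splitting_field hsep
  have hinj : Function.Injective (integralRoot (L := L) hdeg) :=
    fun x y h => Subtype.ext (congrArg (fun r : integralClosure k[X] L => (r : L)) h)
  have hcoe : ∀ (x : (monodromyPoly k f).rootSet L) (p : k[X]),
      ((aeval (integralRoot hdeg x) p : integralClosure k[X] L) : L) = aeval (x : L) p :=
    fun x p => (aeval_algHom_apply ((integralClosure k[X] L).val.restrictScalars k) _ p).symm
  refine ⟨hinj, fun g x => rfl, ?_, ⟨fun x y => ?_⟩, fun x r hr => ?_, fun x => ?_⟩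
  · have hd : (f.map (algebraMap k (integralClosure k[X] L)) -
        C (algebraMap k[X] (integralClosure k[X] L) X)).natDegree = f.natDegree := by
      rw [natDegree_sub_C, natDegree_map]
    have hdvd : Lagrange.nodal Finset.univ (integralRoot hdeg) ∣
        f.map (algebraMap k (integralClosure k[X] L)) -
          C (algebraMap k[X] (integralClosure k[X] L) X) := by
      refine Lagrange.nodal_dvd_of_isRoot hinj.injOn fun x _ => ?_
      rw [IsRoot, eval_sub, eval_C, eval_map_algebraMap, sub_eq_zero]
      exact Subtype.ext ((hcoe x f).trans (aeval_eq_of_mem_rootSet x.2))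
    rw [eq_leadingCoeff_mul_of_monic_of_dvd_of_natDegree_le Lagrange.nodal_monic hdvd
      (by rw [hd, Lagrange.natDegree_nodal, Finset.card_univ,
        card_rootSet_eq_natDegree hsep hsplits, natDegree_monodromyPoly])]
    rw [leadingCoeff, hd, coeff_sub, coeff_C, if_neg hdeg, sub_zero, coeff_map, leadingCoeff]
  · have hx := minpoly.eq_of_irreducible hirr (mem_rootSet.mp x.2).2
    have hy := minpoly.eq_of_irreducible hirr (mem_rootSet.mp y.2).2
    have := Normal.of_isSplittingField (E := L) (monodromyPoly k f)
    obtain ⟨g, hg⟩ := (Normal.minpoly_eq_iff_mem_orbit L).mp (hy.symm.trans hx)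
    exact ⟨g, Subtype.ext hg⟩
  · have hmem : (r : L) ∈ IntermediateField.adjoin (RatFunc k) {(x : L)} := by
      have : FiniteDimensional (RatFunc k) L :=
        IsSplittingField.finiteDimensional L (monodromyPoly k f)
      rw [← IsGalois.fixedField_fixingSubgroup (IntermediateField.adjoin (RatFunc k) {(x : L)}),
        IntermediateField.mem_fixedField_iff]
      intro g hg
      have hgx : g • x = x := Subtype.ext
        ((IntermediateField.mem_fixingSubgroup_iff _ _).mp hg _
          (IntermediateField.mem_adjoin_simple_self _ _))
      exact Subtype.ext_iff.mp (hr g hgx)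
    obtain ⟨p, hp⟩ := exists_aeval_eq_of_isIntegral x.2 (mem_adjoin_of_mem_adjoin_ratFunc x.2 hmem) r.2
    exact ⟨p, Subtype.ext ((hcoe x p).trans hp)⟩
  · rw [transcendental_iff]
    intro p hp
    refine transcendental_iff.mp (transcendental_of_mem_rootSet x.2) p ?_
    rw [← hcoe x p, hp]; rfl

end SplittingField

end MonodromyPoly

theorem isDoublyTransitive_gal_of_baseChange {F E L : Type*} [Field F] [Field E] [Field L]
    [Algebra F E] [Algebra E L] [Algebra F L] [IsScalarTower F E L] (p : F[X])
    [IsSplittingField E L (p.map (algebraMap F E))]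
    (h : MulAction.IsMultiplyPretransitive (L ≃ₐ[E] L)
      ((p.map (algebraMap F E)).rootSet L) 2) :
    IsDoublyTransitive p.Gal (p.rootSet p.SplittingField) := by
  have hsplits : (p.map (algebraMap F L)).Splits := by
    have := IsSplittingField.splits L (p.map (algebraMap F E))
    rwa [Polynomial.map_map, ← IsScalarTower.algebraMap_eq] at this
  let ι : p.SplittingField →ₐ[F] L := IsSplittingField.lift p.SplittingField p hsplits
  let := ι.toRingHom.toAlgebra
  have : IsScalarTower F p.SplittingField L := IsScalarTower.of_algHom ι
  have hmem : ∀ x ∈ p.rootSet p.SplittingField, ι x ∈ (p.map (algebraMap F E)).rootSet L := by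
    intro x hx
    rw [mem_rootSet'] at hx ⊢
    rw [Polynomial.map_map, ← IsScalarTower.algebraMap_eq, aeval_map_algebraMap,
      aeval_algHom_apply, hx.2, map_zero]
    exact ⟨Polynomial.map_ne_zero (by rintro rfl; simp at hx), rfl⟩
  intro x₁ x₂ y₁ y₂ hx hy
  have hne : ∀ {a b : p.rootSet p.SplittingField}, a ≠ b →
      (⟨ι a, hmem a a.2⟩ : (p.map (algebraMap F E)).rootSet L) ≠ ⟨ι b, hmem b b.2⟩ :=
    fun hab h => hab (Subtype.ext (ι.toRingHom.injective (Subtype.ext_iff.mp h)))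
  obtain ⟨σ, h₁, h₂⟩ := MulAction.is_two_pretransitive_iff.mp h (hne hx) (hne hy)
  have hσ := AlgEquiv.restrictNormal_commutes (σ.restrictScalars F) p.SplittingField
  refine ⟨(σ.restrictScalars F).restrictNormal p.SplittingField, Subtype.ext ?_, Subtype.ext ?_⟩
  · exact ι.toRingHom.injective ((hσ x₁).trans (Subtype.ext_iff.mp h₁))
  · exact ι.toRingHom.injective ((hσ x₂).trans (Subtype.ext_iff.mp h₂))

theorem IsDoublyTransitive.isPrimitiveAction {G α : Type*} [Group G] [MulAction G α]
    (h : IsDoublyTransitive G α) : IsPrimitiveAction G α := by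
  refine ⟨⟨fun x y => ?_⟩, fun B hB => ?_⟩
  · by_cases hxy : x = y
    · exact ⟨1, by rw [one_smul, hxy]⟩
    · obtain ⟨g, hg, -⟩ := h x y y x hxy (Ne.symm hxy)
      exact ⟨g, hg⟩
  · rw [or_iff_not_imp_left, Set.not_subsingleton_iff]
    rintro ⟨a, ha, b, hb, hab⟩
    refine Set.eq_univ_of_forall fun c => ?_
    by_cases hac : a = c
    · exact hac ▸ ha
    obtain ⟨g, hga, rfl⟩ := h a b a c hab hac
    rcases hB g with hg | hg
    · exact hg ▸ Set.mem_image_of_mem _ hb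
    · exact absurd ha (Set.disjoint_left.mp hg ⟨a, ha, hga⟩)

theorem monodromyPoly_map {K k : Type*} [Field K] [Field k] (φ : K →+* k) (f : K[X]) :
    ∃ ψ : RatFunc K →+* RatFunc k, (monodromyPoly K f).map ψ = monodromyPoly k (f.map φ) := by
  have hinj : Function.Injective ((algebraMap k[X] (RatFunc k)).comp (mapRingHom φ)) :=
    (RatFunc.algebraMap_injective k).comp (map_injective φ φ.injective)
  refine ⟨IsFractionRing.lift hinj, ?_⟩
  have hcomp : (IsFractionRing.lift hinj).comp (algebraMap K[X] (RatFunc K)) =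
      (algebraMap k[X] (RatFunc k)).comp (mapRingHom φ) :=
    RingHom.ext fun p => IsFractionRing.lift_algebraMap hinj p
  rw [monodromyPoly_eq_map, monodromyPoly_eq_map, Polynomial.map_map, hcomp, ← Polynomial.map_map]
  congr 1
  simp only [Polynomial.map_sub, Polynomial.map_map, map_C, coe_mapRingHom, map_X,
    mapRingHom_comp_C]

theorem isMultiplyPretransitive_rootSet {k : Type*} [Field k] [IsAlgClosed k] (f : k[X])
    (hn : (f.natDegree : k) ≠ 0)
    (hcrit : ∃ α β : k, α ≠ β ∧ (derivative f).eval α = 0 ∧ (derivative f).eval β = 0)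
    (hdist : ∀ α β : k, (derivative f).eval α = 0 → (derivative f).eval β = 0 →
      f.eval α = f.eval β → α = β) :
    MulAction.IsMultiplyPretransitive
      ((monodromyPoly k f).SplittingField ≃ₐ[RatFunc k] (monodromyPoly k f).SplittingField)
      ((monodromyPoly k f).rootSet (monodromyPoly k f).SplittingField) 2 := by
  have hdeg : f.natDegree ≠ 0 := by rintro h; simp [h] at hn
  have hf : derivative f ≠ 0 := by
    intro h0
    have hsucc : f.natDegree - 1 + 1 = f.natDegree := by omega
    have h := coeff_derivative f (f.natDegree - 1)
    rw [h0, coeff_zero, ← Nat.cast_succ, Nat.succ_eq_add_one, hsucc, zero_eq_mul] at h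
    rcases h with h | h
    · rw [coeff_natDegree, leadingCoeff_eq_zero] at h
      simp [h] at hdeg
    · exact hn h
  have : IsScalarTower k k[X] (monodromyPoly k f).SplittingField :=
    IsScalarTower.of_algebraMap_eq fun a => by
      rw [IsScalarTower.algebraMap_apply k[X] (RatFunc k), ← IsScalarTower.algebraMap_apply k k[X],
        ← IsScalarTower.algebraMap_apply]
  have M := isMonodromyModel_integralRoot (L := (monodromyPoly k f).SplittingField) hf hdeg
  have : Nonempty ((monodromyPoly k f).rootSet (monodromyPoly k f).SplittingField) := by
    have := M.natDegree_eq_card (by rintro rfl; simp at hdeg)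
    exact Fintype.card_pos_iff.mp (by omega)
  exact M.isMultiplyPretransitive hn hcrit hdist

/-- **Proposition.** If `f ∈ K[x]`, `char K ∤ deg f`, and `f` has at least two distinct critical
points and all distinct critical values, then the monodromy group `Mon(f)` is doubly transitive
(in particular, primitive) as a permutation group of the roots of `f(X) - t`. -/
theorem stmt2 {K : Type*} [Field K] (f : K[X])
    (hchar : ¬ (ringChar K ∣ f.natDegree))
    (h2 : ∃ α β : AlgebraicClosure K, α ≠ β ∧
      aeval α (derivative f) = 0 ∧ aeval β (derivative f) = 0)
    (hdist : ∀ α β : AlgebraicClosure K, aeval α (derivative f) = 0 →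
      aeval β (derivative f) = 0 → aeval α f = aeval β f → α = β) :
    IsDoublyTransitive (monodromyPoly K f).Gal
        ((monodromyPoly K f).rootSet (monodromyPoly K f).SplittingField) ∧
      IsPrimitiveAction (monodromyPoly K f).Gal
        ((monodromyPoly K f).rootSet (monodromyPoly K f).SplittingField) := by
  let k := AlgebraicClosure K
  let φ : K →+* k := algebraMap K k
  have heval : ∀ (p : K[X]) (a : k), (p.map φ).eval a = aeval a p := fun p a =>
    eval_map_algebraMap p a
  obtain ⟨ψ, hψ⟩ := monodromyPoly_map φ f
  let := ψ.toAlgebra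
  let L := (monodromyPoly k (f.map φ)).SplittingField
  have hψ' : (monodromyPoly K f).map (algebraMap (RatFunc K) (RatFunc k)) =
    monodromyPoly k (f.map φ) := hψ
  have : IsSplittingField (RatFunc k) L
      ((monodromyPoly K f).map (algebraMap (RatFunc K) (RatFunc k))) := by
    rw [hψ']; infer_instance
  have htwo : IsDoublyTransitive (monodromyPoly K f).Gal
      ((monodromyPoly K f).rootSet (monodromyPoly K f).SplittingField) := by
    apply isDoublyTransitive_gal_of_baseChange (E := RatFunc k) (L := L)
    rw [hψ']
    apply isMultiplyPretransitive_rootSet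
    · rw [natDegree_map, ← map_natCast φ, _root_.map_ne_zero, Ne, ringChar.spec]
      exact hchar
    · simpa only [derivative_map, heval] using h2
    · simpa only [derivative_map, heval] using hdist
  exact ⟨htwo, htwo.isPrimitiveAction⟩
end
end

section
/- Let K be a field with char(K) = 0 and let f ∈ K[x] have at least two distinct critical points and equal critical values at at most two distinct critical points. Suppose f(x) = g(h(x)) with g, h ∈ K[x] and t := deg g > 1. Then either k := deg h ≤ 2, or one of the following holds: (i) f'(x) = a'(x − x₀)^{k₀t−1}(x − x₁)^{k₁t−1}(kx − k₀x₁ − k₁x₀) for some a' ∈ K, integers k₀, k₁ ≥ 1 with k₀ + k₁ = k ≥ 3, and distinct x₀, x₁ in the algebraic closure of K; or (ii) deg h = 3 and f'(x) = a'(x − x₀)^{2t₀+1}(x − x₁)^{t₀}(x − y₀)^{2t₁+1}(x − y₁)^{t₁} for some a' ∈ K, integers t₀, t₁ ≥ 1 with t₀ + t₁ = t − 1, and pairwise distinct x₀, x₁, y₀, y₁ in the algebraic closure of K satisfying 3x₀ = y₀ + 2y₁ and 3y₀ = x₀ + 2x₁. -/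
open Polynomial

noncomputable section

variable {K : Type*} [Field K]

/-- `f` has at least two distinct critical points (in an algebraic closure of `K`). -/
def HasTwoDistinctCriticalPoints (f : K[X]) : Prop :=
  ∃ α β : AlgebraicClosure K, α ≠ β ∧
    aeval α (derivative f) = 0 ∧ aeval β (derivative f) = 0

/-- `f` has equal critical values at at most two distinct critical points: there are no three
pairwise distinct critical points of `f` at which `f` takes the same value. -/
def EqualCriticalValuesAtMostTwo (f : K[X]) : Prop :=
  ¬ ∃ α β γ : AlgebraicClosure K, α ≠ β ∧ α ≠ γ ∧ β ≠ γ ∧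
    aeval α (derivative f) = 0 ∧ aeval β (derivative f) = 0 ∧ aeval γ (derivative f) = 0 ∧
    aeval α f = aeval β f ∧ aeval β f = aeval γ f

/-- A polynomial of positive degree over an algebraically closed field without three distinct
roots is a scalar multiple of `(X - x₀) ^ k₀ * (X - x₁) ^ k₁` for distinct `x₀`, `x₁`, where `k₁` may vanish. -/
theorem exists_eq_mul_pow_mul_pow_of_not_three_roots {L : Type*} [Field L] [IsAlgClosed L]
    [CharZero L] {p : L[X]} (hp : 1 ≤ p.natDegree)
    (hroots : ¬ ∃ a b c, a ≠ b ∧ a ≠ c ∧ b ≠ c ∧ p.eval a = 0 ∧ p.eval b = 0 ∧ p.eval c = 0) :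
    ∃ (x₀ x₁ : L) (k₀ k₁ : ℕ), x₀ ≠ x₁ ∧ 1 ≤ k₀ ∧ k₀ + k₁ = p.natDegree ∧
      p = C p.leadingCoeff * (X - C x₀) ^ k₀ * (X - C x₁) ^ k₁ := by
  classical
  have hp0 : p ≠ 0 := by rintro rfl; simp at hp
  obtain ⟨x₀, hx₀⟩ := IsAlgClosed.exists_root p
    (by rw [degree_eq_natDegree hp0]; exact_mod_cast (by omega : p.natDegree ≠ 0))
  obtain ⟨x₁, hne, hx⟩ : ∃ x₁, x₀ ≠ x₁ ∧ ∀ r ∈ p.roots, r = x₀ ∨ r = x₁ := by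
    by_cases hex : ∃ x₁, x₀ ≠ x₁ ∧ p.eval x₁ = 0
    · obtain ⟨x₁, hne, hx₁⟩ := hex
      refine ⟨x₁, hne, fun r hr => ?_⟩
      by_contra! hr'
      exact hroots ⟨x₀, x₁, r, hne, hr'.1.symm, hr'.2.symm, hx₀, hx₁, (mem_roots'.1 hr).2⟩
    · push Not at hex
      refine ⟨x₀ + 1, by simp, fun r hr => Or.inl ?_⟩
      by_contra hr'
      exact hex r (Ne.symm hr') (mem_roots'.1 hr).2
  have hms : p.roots = Multiset.replicate (p.roots.count x₀) x₀ +
      Multiset.replicate (p.roots.count x₁) x₁ := by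
    ext r
    by_cases hr : r ∈ p.roots
    · rcases hx r hr with rfl | rfl
      · simp [Multiset.count_replicate, hne.symm]
      · simp [Multiset.count_replicate, hne]
    · have h0 : p.roots.count r = 0 := Multiset.count_eq_zero.2 hr
      rw [Multiset.count_add, Multiset.count_replicate, Multiset.count_replicate, h0]
      split_ifs with h1 h2 h2 <;> simp_all
  have hsplit := IsAlgClosed.splits p
  refine ⟨x₀, x₁, p.roots.count x₀, p.roots.count x₁, hne,
    Multiset.one_le_count_iff_mem.2 ((mem_roots hp0).2 hx₀), ?_, ?_⟩
  · rw [hsplit.natDegree_eq_card_roots]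
    conv_rhs => rw [hms]
    simp
  · conv_lhs => rw [hsplit.eq_prod_roots, hms]
    simp [mul_assoc]

/-- A fibre of `H` with at most two points yields a common factor of `H - γ` and the
derivative of `H`, of degree at least `deg H - 2`. -/
theorem exists_dvd_derivative_of_not_three_preimages {L : Type*} [Field L] [IsAlgClosed L]
    [CharZero L] {H : L[X]} (hH : 1 ≤ H.natDegree) {γ : L}
    (hfib : ¬ ∃ a b c, a ≠ b ∧ a ≠ c ∧ b ≠ c ∧
      (H - C γ).eval a = 0 ∧ (H - C γ).eval b = 0 ∧ (H - C γ).eval c = 0) :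
    ∃ P : L[X], P ∣ derivative H ∧ P ∣ H - C γ ∧ H.natDegree ≤ P.natDegree + 2 := by
  obtain ⟨x₀, x₁, k₀, k₁, hne, -, hk, hp⟩ := exists_eq_mul_pow_mul_pow_of_not_three_roots
    (p := H - C γ) (by rwa [natDegree_sub_C]) hfib
  rw [natDegree_sub_C] at hk
  have hd₀ : (X - C x₀) ^ k₀ ∣ H - C γ :=
    ⟨C (H - C γ).leadingCoeff * (X - C x₁) ^ k₁, hp.trans (by ring)⟩
  have hd₁ : (X - C x₁) ^ k₁ ∣ H - C γ :=
    ⟨C (H - C γ).leadingCoeff * (X - C x₀) ^ k₀, hp.trans (by ring)⟩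
  have hcop : IsCoprime ((X - C x₀) ^ (k₀ - 1)) ((X - C x₁) ^ (k₁ - 1)) :=
    (isCoprime_X_sub_C_of_isUnit_sub (sub_ne_zero.2 hne).isUnit).pow
  have hder : derivative (H - C γ) = derivative H := by simp
  refine ⟨(X - C x₀) ^ (k₀ - 1) * (X - C x₁) ^ (k₁ - 1), hcop.mul_dvd ?_ ?_, hcop.mul_dvd ?_ ?_, ?_⟩
  · rw [← hder]; exact pow_sub_one_dvd_derivative_of_pow_dvd hd₀
  · rw [← hder]; exact pow_sub_one_dvd_derivative_of_pow_dvd hd₁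
  · exact (pow_dvd_pow _ (Nat.sub_le _ _)).trans hd₀
  · exact (pow_dvd_pow _ (Nat.sub_le _ _)).trans hd₁
  · rw [((monic_X_sub_C x₀).pow _).natDegree_mul ((monic_X_sub_C x₁).pow _)]
    simp only [natDegree_pow, natDegree_X_sub_C]
    omega

theorem isCoprime_sub_C_sub_C {L : Type*} [Field L] (H : L[X]) {γ δ : L} (hne : γ ≠ δ) :
    IsCoprime (H - C γ) (H - C δ) := by
  have := (isCoprime_X_sub_C_of_isUnit_sub (sub_ne_zero.2 hne).isUnit).map (compRingHom H)
  simpa using this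

/-- A cubic without three distinct roots has a multiple root. -/
theorem exists_eq_sq_mul_of_not_three_roots {L : Type*} [Field L] [IsAlgClosed L]
    [CharZero L] {p : L[X]} (hp : p.natDegree = 3)
    (hroots : ¬ ∃ a b c, a ≠ b ∧ a ≠ c ∧ b ≠ c ∧ p.eval a = 0 ∧ p.eval b = 0 ∧ p.eval c = 0) :
    ∃ x₀ x₁ : L, p = C p.leadingCoeff * (X - C x₀) ^ 2 * (X - C x₁) := by
  obtain ⟨x₀, x₁, k₀, k₁, -, hk₀, hk, h⟩ :=
    exists_eq_mul_pow_mul_pow_of_not_three_roots (by omega) hroots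
  obtain ⟨rfl, rfl⟩ | ⟨rfl, rfl⟩ | ⟨rfl, rfl⟩ :
      k₀ = 3 ∧ k₁ = 0 ∨ k₀ = 2 ∧ k₁ = 1 ∨ k₀ = 1 ∧ k₁ = 2 := by omega
  · exact ⟨x₀, x₀, h.trans (by ring)⟩
  · exact ⟨x₀, x₁, h.trans (by ring)⟩
  · exact ⟨x₁, x₀, h.trans (by ring)⟩

/-- Two values whose fibres under `H` have at most two points each force `deg H ≤ 3`. -/
theorem natDegree_le_of_two_values {L : Type*} [Field L] [IsAlgClosed L]
    [CharZero L] {H : L[X]} (hH : 1 ≤ H.natDegree) {γ δ : L} (hne : γ ≠ δ)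
    (hfib : ∀ ε, ε = γ ∨ ε = δ → ¬ ∃ a b c, a ≠ b ∧ a ≠ c ∧ b ≠ c ∧
      (H - C ε).eval a = 0 ∧ (H - C ε).eval b = 0 ∧ (H - C ε).eval c = 0) :
    H.natDegree ≤ 3 := by
  obtain ⟨P, hP, hPγ, hPd⟩ := exists_dvd_derivative_of_not_three_preimages hH (hfib γ (.inl rfl))
  obtain ⟨Q, hQ, hQδ, hQd⟩ := exists_dvd_derivative_of_not_three_preimages hH (hfib δ (.inr rfl))
  have h0 : derivative H ≠ 0 := fun h => by
    have := derivative_eq_zero.1 h; omega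
  have hcop : IsCoprime P Q :=
    ((isCoprime_sub_C_sub_C H hne).of_isCoprime_of_dvd_left hPγ).of_isCoprime_of_dvd_right hQδ
  have hle := natDegree_le_of_dvd (hcop.mul_dvd hP hQ) h0
  rw [natDegree_mul (ne_zero_of_dvd_ne_zero h0 hP) (ne_zero_of_dvd_ne_zero h0 hQ)] at hle
  have := natDegree_derivative_le H
  omega

/-- Three values whose fibres under `H` have at most two points each force `deg H ≤ 2`. -/
theorem natDegree_le_of_three_values {L : Type*} [Field L] [IsAlgClosed L]
    [CharZero L] {H : L[X]} (hH : 1 ≤ H.natDegree) {γ δ ε : L}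
    (hγδ : γ ≠ δ) (hγε : γ ≠ ε) (hδε : δ ≠ ε)
    (hfib : ∀ η, η = γ ∨ η = δ ∨ η = ε → ¬ ∃ a b c, a ≠ b ∧ a ≠ c ∧ b ≠ c ∧
      (H - C η).eval a = 0 ∧ (H - C η).eval b = 0 ∧ (H - C η).eval c = 0) :
    H.natDegree ≤ 2 := by
  obtain ⟨P, hP, hPγ, hPd⟩ := exists_dvd_derivative_of_not_three_preimages hH (hfib γ (.inl rfl))
  obtain ⟨Q, hQ, hQδ, hQd⟩ :=
    exists_dvd_derivative_of_not_three_preimages hH (hfib δ (.inr (.inl rfl)))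
  obtain ⟨R, hR, hRε, hRd⟩ :=
    exists_dvd_derivative_of_not_three_preimages hH (hfib ε (.inr (.inr rfl)))
  have h0 : derivative H ≠ 0 := fun h => by
    have := derivative_eq_zero.1 h; omega
  have hcop {S T : L[X]} {s t : L} (hst : s ≠ t) (hS : S ∣ H - C s) (hT : T ∣ H - C t) :
      IsCoprime S T :=
    ((isCoprime_sub_C_sub_C H hst).of_isCoprime_of_dvd_left hS).of_isCoprime_of_dvd_right hT
  have hPQ := (hcop hγδ hPγ hQδ).mul_dvd hP hQ
  have hle := natDegree_le_of_dvd
    (((hcop hγε hPγ hRε).mul_left (hcop hδε hQδ hRε)).mul_dvd hPQ hR) h0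
  rw [natDegree_mul (ne_zero_of_dvd_ne_zero h0 hPQ) (ne_zero_of_dvd_ne_zero h0 hR),
    natDegree_mul (ne_zero_of_dvd_ne_zero h0 hP) (ne_zero_of_dvd_ne_zero h0 hQ)] at hle
  have := natDegree_derivative_le H
  omega

/-- The derivative of a cubic `b (X - x₀)² (X - x₁) + γ`. -/
theorem derivative_eq_of_sub_C_eq {L : Type*} [Field L] {H : L[X]} {γ b x₀ x₁ : L}
    (h : H - C γ = C b * (X - C x₀) ^ 2 * (X - C x₁)) :
    derivative H = C b * (X - C x₀) * (3 * X - C (x₀ + 2 * x₁)) := by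
  have hd := congrArg derivative h
  simp only [derivative_sub, derivative_mul, derivative_C, derivative_pow, derivative_X] at hd
  rw [sub_zero] at hd
  rw [hd]
  simp [map_ofNat]
  ring

/-- The double root of one special fibre of a cubic is determined by the other fibre. -/
theorem three_mul_eq_of_cubic_fibres {L : Type*} [Field L] {H : L[X]} {γ δ b x₀ x₁ y₀ y₁ : L}
    (hb : b ≠ 0) (hne : γ ≠ δ)
    (hγ : H - C γ = C b * (X - C x₀) ^ 2 * (X - C x₁))
    (hδ : H - C δ = C b * (X - C y₀) ^ 2 * (X - C y₁)) :
    3 * y₀ = x₀ + 2 * x₁ := by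
  have hxy : y₀ ≠ x₀ := by
    rintro rfl
    have h₁ := congrArg (eval y₀) hγ
    have h₂ := congrArg (eval y₀) hδ
    simp at h₁ h₂
    exact hne ((sub_eq_zero.1 h₁).symm.trans (sub_eq_zero.1 h₂))
  have h := congrArg (eval y₀) ((derivative_eq_of_sub_C_eq hγ).symm.trans
    (derivative_eq_of_sub_C_eq hδ))
  simp [hb, sub_eq_zero, hxy] at h
  exact h

/-- The derivative of `G ∘ H` when the derivative of `G` has a single root, whose fibre under `H`
has two points. -/
theorem derivative_mul_comp_eq_of_one_value {L : Type*} [Field L] {G H : L[X]} {c b γ x₀ x₁ : L}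
    {t k₀ k₁ : ℕ} (ht : 1 ≤ t) (hk₀ : 1 ≤ k₀) (hk₁ : 1 ≤ k₁)
    (hG : derivative G = C c * (X - C γ) ^ (t - 1))
    (hH : H - C γ = C b * (X - C x₀) ^ k₀ * (X - C x₁) ^ k₁) :
    derivative (G.comp H) = C (c * b ^ t) * (X - C x₀) ^ (k₀ * t - 1) *
      (X - C x₁) ^ (k₁ * t - 1) *
      (C ((k₀ + k₁ : ℕ) : L) * X - C ((k₀ : L) * x₁ + (k₁ : L) * x₀)) := by
  obtain ⟨s, rfl⟩ := Nat.exists_eq_add_of_le' ht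
  obtain ⟨i, rfl⟩ := Nat.exists_eq_add_of_le' hk₀
  obtain ⟨j, rfl⟩ := Nat.exists_eq_add_of_le' hk₁
  have hH' : derivative H = derivative (H - C γ) := by simp
  have hi : (i + 1) * (s + 1) - 1 = (i + 1) * s + i := by
    rw [Nat.mul_succ]; omega
  have hj : (j + 1) * (s + 1) - 1 = (j + 1) * s + j := by
    rw [Nat.mul_succ]; omega
  rw [derivative_comp, hG, hH', hi, hj]
  simp only [mul_comp, C_comp, pow_comp, sub_comp, X_comp, hH]
  simp only [derivative_mul, derivative_C, derivative_pow, derivative_sub, derivative_X,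
    Nat.add_sub_cancel, map_mul, map_pow, map_add, map_natCast, Nat.cast_add, Nat.cast_one, map_one,
    mul_pow, ← pow_mul]
  ring

/-- **Proposition.** Let `char K = 0` and let `f ∈ K[x]` have at least two distinct critical
points and equal critical values at at most two distinct critical points. If `f = g ∘ h` with
`t = deg g > 1`, then either `k = deg h ≤ 2`, or `f'` has one of two special shapes. -/
theorem stmt3 [CharZero K] (f g h : K[X])
    (hcp : HasTwoDistinctCriticalPoints f) (hcv : EqualCriticalValuesAtMostTwo f)
    (hfgh : f = g.comp h) (ht : 1 < g.natDegree) :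
    h.natDegree ≤ 2 ∨
    (∃ (a' : K) (x₀ x₁ : AlgebraicClosure K) (k₀ k₁ : ℕ),
      x₀ ≠ x₁ ∧ 1 ≤ k₀ ∧ 1 ≤ k₁ ∧ k₀ + k₁ = h.natDegree ∧ 3 ≤ h.natDegree ∧
      (derivative f).map (algebraMap K (AlgebraicClosure K)) =
        C (algebraMap K (AlgebraicClosure K) a') *
          (X - C x₀) ^ (k₀ * g.natDegree - 1) * (X - C x₁) ^ (k₁ * g.natDegree - 1) *
          (C (h.natDegree : AlgebraicClosure K) * X -
            C ((k₀ : AlgebraicClosure K) * x₁ + (k₁ : AlgebraicClosure K) * x₀))) ∨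
    (h.natDegree = 3 ∧
      ∃ (a' : K) (x₀ x₁ y₀ y₁ : AlgebraicClosure K) (t₀ t₁ : ℕ),
        1 ≤ t₀ ∧ 1 ≤ t₁ ∧ t₀ + t₁ = g.natDegree - 1 ∧
        x₀ ≠ x₁ ∧ x₀ ≠ y₀ ∧ x₀ ≠ y₁ ∧ x₁ ≠ y₀ ∧ x₁ ≠ y₁ ∧ y₀ ≠ y₁ ∧
        3 * x₀ = y₀ + 2 * y₁ ∧ 3 * y₀ = x₀ + 2 * x₁ ∧
        (derivative f).map (algebraMap K (AlgebraicClosure K)) =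
          C (algebraMap K (AlgebraicClosure K) a') *
            (X - C x₀) ^ (2 * t₀ + 1) * (X - C x₁) ^ t₀ *
            (X - C y₀) ^ (2 * t₁ + 1) * (X - C y₁) ^ t₁) := by
  set L := AlgebraicClosure K
  set φ := algebraMap K L
  set G := g.map φ with hGdef
  set H := h.map φ with hHdef
  have hφ : Function.Injective φ := φ.injective
  rcases Nat.lt_or_ge 2 h.natDegree with hk | hk
  swap
  · exact Or.inl hk
  refine Or.inr ?_
  have hHdeg : H.natDegree = h.natDegree := natDegree_map_eq_of_injective hφ h
  have hGdeg : G.natDegree = g.natDegree := natDegree_map_eq_of_injective hφ g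
  have hG'deg : (derivative G).natDegree = g.natDegree - 1 := by
    rw [natDegree_derivative, hGdeg]
  have hf' : (derivative f).map φ = derivative (G.comp H) := by
    rw [hfgh, ← derivative_map, map_comp]
  have hfaeval (x : L) : aeval x f = G.eval (H.eval x) := by
    rw [aeval_def, ← eval_map, hfgh, map_comp, eval_comp]
  have hf'aeval (x : L) : aeval x (derivative f) = (derivative G).eval (H.eval x) *
      (derivative H).eval x := by
    rw [aeval_def, ← eval_map, hf', derivative_comp, eval_mul, eval_comp, mul_comm]
  have hfib (γ : L) (hγ : (derivative G).eval γ = 0) : ¬ ∃ a b c, a ≠ b ∧ a ≠ c ∧ b ≠ c ∧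
      (H - C γ).eval a = 0 ∧ (H - C γ).eval b = 0 ∧ (H - C γ).eval c = 0 := by
    rintro ⟨a, b, c, hab, hac, hbc, ha, hb, hc⟩
    simp only [eval_sub, eval_C, sub_eq_zero] at ha hb hc
    exact hcv ⟨a, b, c, hab, hac, hbc, by simp [hf'aeval, ha, hγ], by simp [hf'aeval, hb, hγ],
      by simp [hf'aeval, hc, hγ], by simp [hfaeval, ha, hb], by simp [hfaeval, hb, hc]⟩
  obtain ⟨γ, δ, t₀, t₁, hγδ, ht₀, htt, hG'⟩ := exists_eq_mul_pow_mul_pow_of_not_three_roots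
    (p := derivative G) (by omega) (by
      rintro ⟨γ, δ, ε, hγδ, hγε, hδε, hγ, hδ, hε⟩
      have := natDegree_le_of_three_values (H := H) (by omega) hγδ hγε hδε (by
        rintro η (rfl | rfl | rfl)
        exacts [hfib _ hγ, hfib _ hδ, hfib _ hε])
      omega)
  rw [hG'deg] at htt
  have hc : (derivative G).leadingCoeff = φ (derivative g).leadingCoeff := by
    rw [hGdef, derivative_map, leadingCoeff_map]
  have hlead (γ : L) : (H - C γ).leadingCoeff = φ h.leadingCoeff := by
    rw [leadingCoeff_sub_of_degree_lt, hHdef, leadingCoeff_map]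
    exact degree_C_le.trans_lt (natDegree_pos_iff_degree_pos.1 (by omega))
  have hb : φ h.leadingCoeff ≠ 0 := by
    rw [Ne, map_eq_zero, leadingCoeff_eq_zero]
    rintro rfl
    simp at hk
  have hγ : (derivative G).eval γ = 0 := by
    rw [hG']
    simp [show t₀ ≠ 0 by omega]
  rw [hc] at hG'
  rcases Nat.eq_zero_or_pos t₁ with rfl | ht₁
  · left
    obtain ⟨x₀, x₁, k₀, k₁, hne, hk₀, hkk, hH⟩ := exists_eq_mul_pow_mul_pow_of_not_three_roots
      (p := H - C γ) (by rw [natDegree_sub_C]; omega) (hfib γ hγ)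
    rw [natDegree_sub_C, hHdeg] at hkk
    rw [hlead] at hH
    obtain rfl : t₀ = g.natDegree - 1 := by omega
    rw [pow_zero, mul_one] at hG'
    rcases Nat.eq_zero_or_pos k₁ with rfl | hk₁
    · exfalso
      rw [pow_zero, mul_one] at hH
      have hcrit (x : L) (hx : aeval x (derivative f) = 0) : x = x₀ := by
        have hH' : derivative H = derivative (H - C γ) := by simp
        have hHx : H.eval x - γ = φ h.leadingCoeff * (x - x₀) ^ k₀ := by
          simpa using congrArg (eval x) hH
        rw [hf'aeval, hG', hH', hH] at hx
        simp [hb, hHx, sub_eq_zero, derivative_pow, show k₀ ≠ 0 by omega] at hx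
        have hg : g ≠ 0 := by rintro rfl; simp at ht
        have hg1 : g.natDegree ≠ 0 := by omega
        tauto
      obtain ⟨α, β, hαβ, hα, hβ⟩ := hcp
      exact hαβ ((hcrit α hα).trans (hcrit β hβ).symm)
    · refine ⟨(derivative g).leadingCoeff * h.leadingCoeff ^ g.natDegree, x₀, x₁, k₀, k₁, hne, hk₀,
        hk₁, hkk, hk, ?_⟩
      rw [hf', derivative_mul_comp_eq_of_one_value (by omega) hk₀ hk₁ hG' hH, hkk]
      simp only [map_mul, map_pow]
  · right
    have hδ : (derivative G).eval δ = 0 := by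
      rw [hG']
      simp [show t₁ ≠ 0 by omega]
    have hk3 := natDegree_le_of_two_values (H := H) (by omega) hγδ (by
      rintro η (rfl | rfl)
      exacts [hfib _ hγ, hfib _ hδ])
    obtain ⟨x₀, x₁, hx⟩ := exists_eq_sq_mul_of_not_three_roots (p := H - C γ)
      (by rw [natDegree_sub_C]; omega) (hfib γ hγ)
    obtain ⟨y₀, y₁, hy⟩ := exists_eq_sq_mul_of_not_three_roots (p := H - C δ)
      (by rw [natDegree_sub_C]; omega) (hfib δ hδ)
    rw [hlead] at hx hy
    have hyx := three_mul_eq_of_cubic_fibres hb hγδ hx hy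
    have hxy := three_mul_eq_of_cubic_fibres hb hγδ.symm hy hx
    have hdisj {z : L} (hzγ : H.eval z - γ = 0) : H.eval z - δ ≠ 0 := fun hzδ =>
      hγδ ((sub_eq_zero.1 hzγ).symm.trans (sub_eq_zero.1 hzδ))
    have hevx (z : L) : H.eval z - γ = φ h.leadingCoeff * (z - x₀) ^ 2 * (z - x₁) := by
      simpa using congrArg (eval z) hx
    have hevy (z : L) : H.eval z - δ = φ h.leadingCoeff * (z - y₀) ^ 2 * (z - y₁) := by
      simpa using congrArg (eval z) hy
    have hx₀ := hdisj (z := x₀) (by simp [hevx])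
    have hx₁ := hdisj (z := x₁) (by simp [hevx])
    simp only [hevy, ne_eq, mul_eq_zero, hb, sub_eq_zero, pow_eq_zero_iff, OfNat.ofNat_ne_zero,
      not_false_eq_true, false_or, not_or] at hx₀ hx₁
    have h3 : (3 : L) ≠ 0 := by norm_num
    refine ⟨by omega, 3 * (derivative g).leadingCoeff * h.leadingCoeff ^ g.natDegree,
      x₀, x₁, y₀, y₁, t₀, t₁, ht₀, ht₁, htt, ?_, hx₀.1, hx₀.2, hx₁.1, hx₁.2, ?_, hxy, hyx, ?_⟩
    · rintro rfl
      exact hx₀.1 (mul_left_cancel₀ h3 (by linear_combination -hyx))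
    · rintro rfl
      exact hx₀.1 (mul_left_cancel₀ h3 (by linear_combination hxy))
    · have ht : g.natDegree = t₀ + t₁ + 1 := by omega
      rw [hf', derivative_comp, derivative_eq_of_sub_C_eq hx, ← hyx, hG', ht]
      simp only [mul_comp, C_comp, pow_comp, sub_comp, X_comp, hx, hy]
      simp only [map_mul, map_pow, map_ofNat, mul_pow, ← pow_mul]
      ring
end
end

section
/- Let K be a field with char(K) = 0 and let a ∈ K be nonzero. If n ≥ 4, then there exist two distinct critical points α, β of the Dickson polynomial D_n(x, a) (in an algebraic closure of K) with D_n(α, a) = D_n(β, a). If n ≥ 6, then there exist three pairwise distinct critical points of D_n(x, a) at which D_n(·, a) takes the same value. -/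
open Polynomial

noncomputable section

/-- The functional equation `D_m(y + z, yz) = y ^ m + z ^ m`. -/
theorem eval_add_dickson_one_mul {R : Type*} [CommRing R] (y z : R) :
    ∀ m : ℕ, eval (y + z) (dickson 1 (y * z) m) = y ^ m + z ^ m
  | 0 => by rw [dickson_zero]; norm_num
  | 1 => by simp
  | m + 2 => by
    simp only [dickson_add_two, eval_sub, eval_mul, eval_X, eval_C,
      eval_add_dickson_one_mul y z (m + 1), eval_add_dickson_one_mul y z m]
    ring

theorem sub_mul_eval_add_derivative_dickson_one_mul {R : Type*} [CommRing R] (y z : R) :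
    ∀ m : ℕ, (y - z) * eval (y + z) (derivative (dickson 1 (y * z) m)) = m * (y ^ m - z ^ m)
  | 0 => by
    have h : (3 - ((1 : ℕ) : R[X])) = C 2 := by rw [C_ofNat]; norm_num
    rw [dickson_zero, h, derivative_C]; simp
  | 1 => by simp
  | m + 2 => by
    have h₁ := sub_mul_eval_add_derivative_dickson_one_mul y z (m + 1)
    have h₀ := sub_mul_eval_add_derivative_dickson_one_mul y z m
    simp only [dickson_add_two, derivative_sub, derivative_mul, derivative_X, derivative_C,
      eval_sub, eval_add, eval_mul, eval_X, eval_C, eval_one, eval_zero,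
      eval_add_dickson_one_mul]
    push_cast at h₁ ⊢
    linear_combination (y + z) * h₁ - y * z * h₀

/-- If `ζ ^ n = -1` and `ζ ^ 2 ≠ 1`, then `b (ζ + ζ⁻¹)` is a critical point of `D_n(x, b ^ 2)`
with critical value `-2 b ^ n`. -/
theorem dickson_critical_of_pow_eq_neg_one {L : Type*} [Field L] {b ζ : L} {n : ℕ}
    (hb : b ≠ 0) (hζ : ζ ^ n = -1) (h0 : ζ ≠ 0) (h2 : ζ ^ 2 ≠ 1) :
    eval (b * ζ + b * ζ⁻¹) (derivative (dickson 1 (b ^ 2) n)) = 0 ∧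
      eval (b * ζ + b * ζ⁻¹) (dickson 1 (b ^ 2) n) = -2 * b ^ n := by
  have hmul : b ^ 2 = b * ζ * (b * ζ⁻¹) := by field_simp
  have hinv : ζ⁻¹ ^ n = -1 := by rw [inv_pow, hζ]; norm_num
  constructor
  · have h := sub_mul_eval_add_derivative_dickson_one_mul (b * ζ) (b * ζ⁻¹) n
    rw [← hmul, mul_pow, mul_pow, hζ, hinv, sub_self, mul_zero] at h
    refine (mul_eq_zero.mp h).resolve_left fun h' ↦ h2 ?_
    have := mul_left_cancel₀ hb (sub_eq_zero.mp h')
    rw [sq]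
    nth_rewrite 2 [this]
    exact mul_inv_cancel₀ h0
  · rw [hmul, eval_add_dickson_one_mul, mul_pow, mul_pow, hζ, hinv]
    ring

theorem mul_add_mul_inv_ne {L : Type*} [Field L] {b ζ ξ : L} (hb : b ≠ 0) (hζ : ζ ≠ 0)
    (hξ : ξ ≠ 0) (hne : ζ ≠ ξ) (hmul : ζ * ξ ≠ 1) :
    b * ζ + b * ζ⁻¹ ≠ b * ξ + b * ξ⁻¹ := by
  intro h
  have h' : (ζ - ξ) * (ζ * ξ - 1) = 0 := by
    field_simp at h
    linear_combination h
  rcases mul_eq_zero.mp h' with h' | h'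
  · exact hne (sub_eq_zero.mp h')
  · exact hmul (sub_eq_zero.mp h')

/-- **Corollary.** Let `char K = 0` and `a ≠ 0`. If `n ≥ 4`, the Dickson polynomial `Dₙ(x, a)`
has two distinct critical points (in an algebraic closure of `K`) with equal critical values;
if `n ≥ 6`, it has three pairwise distinct critical points with equal critical values. -/
theorem stmt7 {K : Type*} [Field K] [CharZero K] (a : K) (ha : a ≠ 0) (n : ℕ) :
    (4 ≤ n → ∃ α β : AlgebraicClosure K, α ≠ β ∧
      aeval α (derivative (dickson 1 a n)) = 0 ∧ aeval β (derivative (dickson 1 a n)) = 0 ∧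
      aeval α (dickson 1 a n) = aeval β (dickson 1 a n)) ∧
    (6 ≤ n → ∃ α β γ : AlgebraicClosure K, α ≠ β ∧ α ≠ γ ∧ β ≠ γ ∧
      aeval α (derivative (dickson 1 a n)) = 0 ∧ aeval β (derivative (dickson 1 a n)) = 0 ∧
      aeval γ (derivative (dickson 1 a n)) = 0 ∧
      aeval α (dickson 1 a n) = aeval β (dickson 1 a n) ∧
      aeval β (dickson 1 a n) = aeval γ (dickson 1 a n)) := by
  rcases Nat.eq_zero_or_pos n with rfl | hn
  · simp
  obtain ⟨b, hb⟩ := IsAlgClosed.exists_pow_nat_eq (algebraMap K (AlgebraicClosure K) a) two_pos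
  have hb0 : b ≠ 0 := by
    rintro rfl
    exact ha ((map_eq_zero (algebraMap K (AlgebraicClosure K))).mp (by rw [← hb]; simp))
  have : NeZero (2 * n) := ⟨by omega⟩
  obtain ⟨η, hη⟩ := HasEnoughRootsOfUnity.exists_primitiveRoot (AlgebraicClosure K) (2 * n)
  have hη0 : η ≠ 0 := hη.ne_zero (by omega)
  have hηn : η ^ n = -1 := (hη.pow (by omega) (mul_comm 2 n)).eq_neg_one_of_two_right
  have crit (k : ℕ) (hk : Odd k) (hkn : k < n) :
      aeval (b * η ^ k + b * (η ^ k)⁻¹) (derivative (dickson 1 a n)) = 0 ∧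
      aeval (b * η ^ k + b * (η ^ k)⁻¹) (dickson 1 a n) = -2 * b ^ n := by
    rw [aeval_def, aeval_def, ← eval_map, ← eval_map, ← derivative_map, map_dickson, ← hb]
    refine dickson_critical_of_pow_eq_neg_one hb0 ?_ (pow_ne_zero k hη0) ?_
    · rw [pow_right_comm, hηn, hk.neg_one_pow]
    · rw [← pow_mul]
      exact hη.pow_ne_one_of_pos_of_lt (by have := hk.pos; omega) (by omega)
  have distinct (j k : ℕ) (hjk : j < k) (hk : k < n) :
      b * η ^ j + b * (η ^ j)⁻¹ ≠ b * η ^ k + b * (η ^ k)⁻¹ := by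
    refine mul_add_mul_inv_ne hb0 (pow_ne_zero j hη0) (pow_ne_zero k hη0) ?_ ?_
    · exact fun h ↦ hjk.ne (hη.pow_inj (by omega) (by omega) h)
    · rw [← pow_add]
      exact hη.pow_ne_one_of_pos_of_lt (by omega) (by omega)
  refine ⟨fun h4 ↦ ?_, fun h6 ↦ ?_⟩
  · have c₁ := crit 1 (by decide) (by omega)
    have c₃ := crit 3 (by decide) (by omega)
    exact ⟨_, _, distinct 1 3 (by omega) (by omega), c₁.1, c₃.1, c₁.2.trans c₃.2.symm⟩
  · have c₁ := crit 1 (by decide) (by omega)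
    have c₃ := crit 3 (by decide) (by omega)
    have c₅ := crit 5 (by decide) (by omega)
    exact ⟨_, _, _, distinct 1 3 (by omega) (by omega), distinct 1 5 (by omega) (by omega),
      distinct 3 5 (by omega) (by omega), c₁.1, c₃.1, c₅.1, c₁.2.trans c₃.2.symm,
      c₃.2.trans c₅.2.symm⟩
end
end

section
/- Let K be a field with char(K) = 0, f ∈ K[x] with deg f = n ≥ 1, and x₀ an element of an algebraic closure of K. If e₁, e₂, …, e_k are the multiplicities of the distinct roots of f(x) − x₀ in the algebraic closure, then the monodromy group Mon(f) contains a permutation whose cycle lengths are exactly e₁, e₂, …, e_k. Furthermore, Mon(f) contains an n-cycle. -/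
open Polynomial

open scoped Classical

noncomputable section

/-- If the orbits of `σ` are exactly the fibers of `π : α → R` over a finite set `s`, then the
cycle lengths of `σ` (including fixed points) are the cardinalities of these fibers. -/
theorem Equiv.Perm.parts_partition_of_fibers {α R : Type*} [Fintype α] [DecidableEq α]
    (σ : Equiv.Perm α) (s : Finset R) (e : R → ℕ) (π : α → R) (hπ : ∀ a, π a ∈ s)
    (hcard : ∀ r ∈ s, (Finset.univ.filter fun a => π a = r).card = e r)
    (he : ∀ r ∈ s, e r ≠ 0) (hσ : ∀ a b, σ.SameCycle a b ↔ π a = π b) :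
    σ.partition.parts = s.val.map e := by
  have hne : ∀ r ∈ s, ∃ a, π a = r := fun r hr => by
    have : 0 < (Finset.univ.filter fun a => π a = r).card := by
      rw [hcard r hr]; exact Nat.pos_of_ne_zero (he r hr)
    obtain ⟨a, ha⟩ := Finset.card_pos.mp this
    exact ⟨a, by simpa using ha⟩
  choose x hx using hne
  have hfix : ∀ a, σ a ≠ a ↔ 2 ≤ e (π a) := by
    intro a
    rw [← hcard _ (hπ a)]
    constructor
    · intro h
      refine Finset.one_lt_card.mpr ⟨σ a, ?_, a, by simp, h⟩
      simpa using ((hσ a (σ a)).mp ⟨1, by simp⟩).symm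
    · intro h hfa
      obtain ⟨b, hb, hba⟩ := Finset.exists_mem_ne h a
      obtain ⟨i, hi⟩ := (hσ a b).mpr (by simpa using hb : π b = π a).symm
      exact hba (hi.symm.trans (Equiv.Perm.zpow_apply_eq_self_of_apply_eq_self hfa i))
  have hsupp : ∀ r (hrs : r ∈ s), 2 ≤ e r → (σ.cycleOf (x r hrs)).support.card = e r := by
    intro r hrs hr2
    rw [← hcard r hrs]
    congr 1
    ext b
    have hxm : σ (x r hrs) ≠ x r hrs := (hfix _).mpr (by rw [hx r hrs]; exact hr2)
    rw [Equiv.Perm.mem_support_cycleOf_iff' hxm, hσ, hx r hrs]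
    simp [eq_comm]
  have hct : σ.cycleType = (s.filter fun r => 2 ≤ e r).val.map e := by
    rw [Equiv.Perm.cycleType_def]
    symm
    refine Multiset.map_eq_map_of_bij_of_nodup _ _ (Finset.nodup _) (Finset.nodup _)
      (fun r hr => σ.cycleOf (x r (Finset.mem_filter.mp hr).1)) ?_ ?_ ?_ ?_
    · intro r hr
      obtain ⟨hrs, hr2⟩ := Finset.mem_filter.mp hr
      refine Equiv.Perm.cycleOf_mem_cycleFactorsFinset_iff.mpr ?_
      rw [Equiv.Perm.mem_support, hfix, hx r hrs]
      exact hr2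
    · intro r hr r' hr' h
      obtain ⟨hrs, hr2⟩ := Finset.mem_filter.mp hr
      obtain ⟨hrs', hr2'⟩ := Finset.mem_filter.mp hr'
      have hxm : σ (x r hrs) ≠ x r hrs := (hfix _).mpr (by rw [hx r hrs]; exact hr2)
      have hxm' : σ (x r' hrs') ≠ x r' hrs' := (hfix _).mpr (by rw [hx r' hrs']; exact hr2')
      have h1 : x r' hrs' ∈ (σ.cycleOf (x r hrs)).support := by
        rw [h, Equiv.Perm.mem_support_cycleOf_iff' hxm']
      rw [Equiv.Perm.mem_support_cycleOf_iff' hxm, hσ, hx r hrs, hx r' hrs'] at h1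
      exact h1
    · intro c hc
      have hc' : c ∈ σ.cycleFactorsFinset := hc
      obtain ⟨a, ha⟩ := (Equiv.Perm.mem_cycleFactorsFinset_iff.mp hc').1.nonempty_support
      have hca := Equiv.Perm.cycle_is_cycleOf ha hc'
      have ha2 := (hfix a).mp (Equiv.Perm.mem_support.mp
        (Equiv.Perm.mem_cycleFactorsFinset_support_le hc' ha))
      refine ⟨π a, Finset.mem_filter.mpr ⟨hπ a, ha2⟩, ?_⟩
      rw [hca]
      exact ((hσ _ _).mpr (hx _ (hπ a))).cycleOf_eq
    · intro r hr
      obtain ⟨hrs, hr2⟩ := Finset.mem_filter.mp hr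
      exact (hsupp r hrs hr2).symm
  have hone : (s.filter fun r => ¬ 2 ≤ e r).val.map e =
      Multiset.replicate (s.filter fun r => ¬ 2 ≤ e r).card 1 := by
    refine Multiset.eq_replicate.mpr ⟨Multiset.card_map _ _, ?_⟩
    intro b hb
    obtain ⟨r, hr, rfl⟩ := Multiset.mem_map.mp hb
    obtain ⟨hrs, hr2⟩ := Finset.mem_filter.mp hr
    have := he r hrs
    omega
  have htot : Fintype.card α = ∑ r ∈ s, e r := by
    rw [← Finset.card_univ, Finset.card_eq_sum_card_fiberwise (f := π) (t := s)
      (fun a _ => hπ a)]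
    exact Finset.sum_congr rfl hcard
  have hsum : σ.support.card = ∑ r ∈ s.filter (fun r => 2 ≤ e r), e r := by
    rw [← Equiv.Perm.sum_cycleType, hct]
    rfl
  have hsum1 : ∑ r ∈ s.filter (fun r => ¬ 2 ≤ e r), e r =
      (s.filter fun r => ¬ 2 ≤ e r).card := by
    have := congrArg Multiset.sum hone
    rwa [Multiset.sum_replicate, smul_eq_mul, mul_one] at this
  have hsplit := Finset.sum_filter_add_sum_filter_not s (fun r => 2 ≤ e r) e
  rw [Equiv.Perm.parts_partition, hct]
  have hdiff : Fintype.card α - σ.support.card = (s.filter fun r => ¬ 2 ≤ e r).card := by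
    omega
  rw [hdiff, ← hone, ← Multiset.map_add]
  congr 1
  exact Multiset.filter_add_not (fun r => 2 ≤ e r) s.val

/-- If `σ` acts on a set parametrized by pairs `(r, z)` with `r ∈ s` and `z ^ e r = b r` by
multiplying `z` by a primitive `e r`-th root of unity, then the cycle lengths of `σ`
are the numbers `e r`. -/
theorem Equiv.Perm.parts_partition_of_rotation {α L R C : Type*} [Fintype α] [DecidableEq α]
    [Field C] [IsAlgClosed C] (σ : Equiv.Perm α) (j : α → L) (hj : Function.Injective j)
    (τ : L → L) (hστ : ∀ a, j (σ a) = τ (j a))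
    (s : Finset R) (e : R → ℕ) (b ξ : R → C) (ρ : R → C → L)
    (he : ∀ r ∈ s, e r ≠ 0) (hb : ∀ r ∈ s, b r ≠ 0)
    (hξ : ∀ r ∈ s, IsPrimitiveRoot (ξ r) (e r))
    (hsub : ∀ a, ∃ r ∈ s, ∃ z, z ^ e r = b r ∧ ρ r z = j a)
    (hsurj : ∀ r ∈ s, ∀ z, z ^ e r = b r → ∃ a, j a = ρ r z)
    (hinj : ∀ r ∈ s, ∀ z, z ^ e r = b r → ∀ r' ∈ s, ∀ z', z' ^ e r' = b r' →
      ρ r z = ρ r' z' → r = r' ∧ z = z')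
    (hτ : ∀ r ∈ s, ∀ z, z ^ e r = b r → τ (ρ r z) = ρ r (ξ r * z)) :
    σ.partition.parts = s.val.map e := by
  choose π hπ ζ hζ hρ using hsub
  have huniq : ∀ a r z, r ∈ s → z ^ e r = b r → j a = ρ r z → π a = r ∧ ζ a = z :=
    fun a r z hr hz h => hinj _ (hπ a) _ (hζ a) r hr z hz ((hρ a).trans h)
  have hπζ : ∀ a a', π a = π a' → ζ a = ζ a' → a = a' := by
    intro a a' h h'
    apply hj
    rw [← hρ, ← hρ, h, h']
  have hstep : ∀ a, π (σ a) = π a ∧ ζ (σ a) = ξ (π a) * ζ a := by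
    intro a
    refine huniq _ _ _ (hπ a) ?_ ?_
    · rw [mul_pow, (hξ _ (hπ a)).pow_eq_one, one_mul, hζ]
    · rw [hστ, ← hρ, hτ _ (hπ a) _ (hζ a)]
  have hpow : ∀ (k : ℕ) a, π ((σ ^ k) a) = π a ∧ ζ ((σ ^ k) a) = ξ (π a) ^ k * ζ a := by
    intro k a
    induction k with
    | zero => simp
    | succ k ih =>
      rw [pow_succ', Equiv.Perm.mul_apply, (hstep _).1, (hstep _).2, ih.1, ih.2, pow_succ',
        mul_assoc]
      exact ⟨rfl, rfl⟩
  refine σ.parts_partition_of_fibers s e π hπ ?_ he ?_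
  · intro r hr
    have hcard : (nthRoots (e r) (b r)).toFinset.card = e r := by
      rw [Multiset.toFinset_card_of_nodup ((hξ r hr).nthRoots_nodup (hb r hr)),
        (hξ r hr).card_nthRoots,
        if_pos (IsAlgClosed.exists_pow_nat_eq (b r) (Nat.pos_of_ne_zero (he r hr)))]
    rw [← hcard]
    refine Finset.card_bij (fun a _ => ζ a) ?_ ?_ ?_
    · intro a ha
      obtain rfl : π a = r := by simpa using ha
      rw [Multiset.mem_toFinset, mem_nthRoots (Nat.pos_of_ne_zero (he _ hr)), hζ]
    · intro a ha a' ha' h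
      have h1 : π a = r := by simpa using ha
      have h1' : π a' = r := by simpa using ha'
      exact hπζ _ _ (h1.trans h1'.symm) h
    · intro z hz
      rw [Multiset.mem_toFinset, mem_nthRoots (Nat.pos_of_ne_zero (he _ hr))] at hz
      obtain ⟨a, ha⟩ := hsurj r hr z hz
      obtain ⟨h1, h2⟩ := huniq a r z hr hz ha
      exact ⟨a, by simpa using h1, h2⟩
  · intro a a'
    constructor
    · intro h
      obtain ⟨k, hk⟩ := h.exists_nat_pow_eq
      rw [← hk, (hpow k a).1]
    · intro h
      have hz0 : ζ a ≠ 0 := by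
        intro h0
        have := hζ a
        rw [h0, zero_pow (he _ (hπ a))] at this
        exact hb _ (hπ a) this.symm
      have hq : (ζ a' / ζ a) ^ e (π a) = 1 := by
        rw [div_pow, hζ, h, hζ, div_self (hb _ (hπ a'))]
      have : NeZero (e (π a)) := ⟨he _ (hπ a)⟩
      obtain ⟨k, -, hk⟩ := (hξ _ (hπ a)).eq_pow_of_pow_eq_one hq
      refine ⟨k, ?_⟩
      rw [zpow_natCast]
      refine hπζ _ _ ((hpow k a).1.trans h) ?_
      rw [(hpow k a).2, hk, div_mul_cancel₀ _ hz0]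

/-- If the roots of `p` in an extension `L` are parametrized by pairs `(r, z)` with `r ∈ s` and
`z ^ e r = b r`, and an endomorphism of `L` over `F` multiplies `z` by a primitive `e r`-th root
of unity, then some element of the Galois group of `p` has cycle lengths `e r`. -/
theorem Polynomial.Gal.exists_parts_partition {F L R C : Type*} [Field F] [Field L] [Algebra F L]
    [Field C] [IsAlgClosed C] (p : F[X]) (hp : p ≠ 0) (τ : L →ₐ[F] L)
    (s : Finset R) (e : R → ℕ) (b ξ : R → C) (ρ : R → C → L)
    (he : ∀ r ∈ s, e r ≠ 0) (hb : ∀ r ∈ s, b r ≠ 0)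
    (hξ : ∀ r ∈ s, IsPrimitiveRoot (ξ r) (e r))
    (hroot : ∀ r ∈ s, ∀ z, z ^ e r = b r → aeval (ρ r z) p = 0)
    (hinj : ∀ r ∈ s, ∀ z, z ^ e r = b r → ∀ r' ∈ s, ∀ z', z' ^ e r' = b r' →
      ρ r z = ρ r' z' → r = r' ∧ z = z')
    (hτ : ∀ r ∈ s, ∀ z, z ^ e r = b r → τ (ρ r z) = ρ r (ξ r * z))
    (hsum : ∑ r ∈ s, e r = p.natDegree) :
    ∃ σ : p.Gal, (MulAction.toPerm σ :
      Equiv.Perm (p.rootSet p.SplittingField)).partition.parts = s.val.map e := by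
  have hcardroots : ∀ r ∈ s, (nthRoots (e r) (b r)).toFinset.card = e r := by
    intro r hr
    rw [Multiset.toFinset_card_of_nodup ((hξ r hr).nthRoots_nodup (hb r hr)),
      (hξ r hr).card_nthRoots,
      if_pos (IsAlgClosed.exists_pow_nat_eq (b r) (Nat.pos_of_ne_zero (he r hr)))]
  have hmem : ∀ r ∈ s, ∀ z, z ∈ (nthRoots (e r) (b r)).toFinset ↔ z ^ e r = b r := by
    intro r hr z
    rw [Multiset.mem_toFinset, mem_nthRoots (Nat.pos_of_ne_zero (he r hr))]
  have hP : p.map (algebraMap F L) ≠ 0 := Polynomial.map_ne_zero hp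
  set S : Finset (Σ _ : R, C) := s.sigma fun r => (nthRoots (e r) (b r)).toFinset with hS
  have hSmem : ∀ y, y ∈ S ↔ y.1 ∈ s ∧ y.2 ^ e y.1 = b y.1 := by
    intro y
    rw [hS, Finset.mem_sigma]
    exact and_congr_right fun h => hmem _ h _
  set I : Finset L := S.image fun y => ρ y.1 y.2 with hI
  have hIcard : I.card = p.natDegree := by
    rw [hI, Finset.card_image_of_injOn, hS, Finset.card_sigma, ← hsum]
    · exact Finset.sum_congr rfl hcardroots
    · rintro ⟨r, z⟩ h ⟨r', z'⟩ h' heq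
      obtain ⟨h1, h2⟩ := (hSmem _).mp h
      obtain ⟨h1', h2'⟩ := (hSmem _).mp h'
      obtain ⟨rfl, rfl⟩ := hinj r h1 z h2 r' h1' z' h2' heq
      rfl
  have hIle : I.val ≤ (p.map (algebraMap F L)).roots := by
    rw [Multiset.le_iff_subset I.nodup]
    intro x hx
    obtain ⟨y, hy, rfl⟩ := Finset.mem_image.mp hx
    obtain ⟨h1, h2⟩ := (hSmem _).mp hy
    rw [mem_roots hP, IsRoot, eval_map_algebraMap]
    exact hroot _ h1 _ h2
  have hIeq : I.val = (p.map (algebraMap F L)).roots := by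
    refine Multiset.eq_of_le_of_card_le hIle ?_
    have := (p.map (algebraMap F L)).card_roots'
    rw [natDegree_map] at this
    exact this.trans hIcard.ge
  have hsplits : (p.map (algebraMap F L)).Splits := by
    rw [splits_iff_card_roots, ← hIeq, natDegree_map]
    exact hIcard
  have : Fact (p.map (algebraMap F L)).Splits := ⟨hsplits⟩
  let σ : p.Gal := τ.restrictNormal' p.SplittingField
  have hσ : ∀ x : p.SplittingField,
      algebraMap p.SplittingField L (σ x) = τ (algebraMap p.SplittingField L x) :=
    fun x => τ.restrictNormal_commutes p.SplittingField x
  have hστ : ∀ a : p.rootSet p.SplittingField, (mapRoots p L ((MulAction.toPerm σ :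
      Equiv.Perm (p.rootSet p.SplittingField)) a) : L) = τ (mapRoots p L a) := fun a => hσ a
  refine ⟨σ, Equiv.Perm.parts_partition_of_rotation _
    (fun a => (mapRoots p L a : L)) (Subtype.val_injective.comp (mapRoots_bijective p L).1)
    τ hστ s e b ξ ρ he hb hξ ?_ ?_ hinj hτ⟩
  · intro a
    have ha : (mapRoots p L a : L) ∈ I := by
      rw [← Finset.mem_val, hIeq]
      have := (mapRoots p L a).2
      rw [mem_rootSet] at this
      rw [mem_roots hP, IsRoot, eval_map_algebraMap]
      exact this.2
    obtain ⟨y, hy, h⟩ := Finset.mem_image.mp ha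
    exact ⟨y.1, ((hSmem _).mp hy).1, y.2, ((hSmem _).mp hy).2, h⟩
  · intro r hr z hz
    obtain ⟨a, ha⟩ := (mapRoots_bijective p L).2
      ⟨ρ r z, mem_rootSet.mpr ⟨hp, hroot r hr z hz⟩⟩
    exact ⟨a, by rw [ha]⟩

theorem Polynomial.constantCoeff_eval_powerSeries {k : Type*} [CommRing k]
    (P : Polynomial (PowerSeries k)) (T : PowerSeries k) : PowerSeries.constantCoeff (P.eval T) =
      (P.map (PowerSeries.constantCoeff (R := k))).eval (PowerSeries.constantCoeff T) := by
  rw [eval_map, eval₂_at_apply]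

theorem Polynomial.isUnit_eval_derivative_powerSeries {k : Type*} [Field k] [CharZero k] {n e : ℕ}
    (he : e ≠ 0) (hen : e ≤ n) {b : k} (hb : b ≠ 0) {Q : Polynomial (PowerSeries k)}
    (hQ0 : Q.map (PowerSeries.constantCoeff (R := k)) = C b * X ^ (n - e)) {T : PowerSeries k}
    (hT : PowerSeries.constantCoeff T ^ e = b) : IsUnit ((X ^ n - Q).derivative.eval T) := by
  rw [PowerSeries.isUnit_iff_constantCoeff, constantCoeff_eval_powerSeries, ← derivative_map,
    Polynomial.map_sub, hQ0, isUnit_iff_ne_zero]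
  set z := PowerSeries.constantCoeff T
  have hz : z ≠ 0 := by
    intro h
    rw [h, zero_pow he] at hT
    exact hb hT.symm
  have key : z * (derivative ((X ^ n).map (PowerSeries.constantCoeff (R := k)) -
      C b * X ^ (n - e))).eval z = e * z ^ n := by
    have hmul : ∀ m : ℕ, z * ((m : k) * z ^ (m - 1)) = m * z ^ m := by
      intro m
      rcases m with _ | m
      · simp
      · simp only [Nat.add_sub_cancel]; ring
    simp only [Polynomial.map_pow, map_X, derivative_sub, derivative_X_pow, derivative_C_mul,
      eval_sub, eval_mul, eval_C, eval_natCast, eval_pow, eval_X, map_natCast]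
    rw [mul_sub, hmul, mul_left_comm, hmul, ← hT, mul_left_comm, ← pow_add,
      Nat.add_sub_cancel' hen, Nat.cast_sub hen]
    ring
  intro h
  rw [h, mul_zero] at key
  exact mul_ne_zero (Nat.cast_ne_zero.mpr he) (pow_ne_zero n hz) key.symm

theorem Polynomial.exists_powerSeries_pow_eq_eval {k : Type*} [Field k] [CharZero k] {n e : ℕ}
    (he : e ≠ 0) (hen : e ≤ n) {b z : k} (hb : b ≠ 0) (hz : z ^ e = b)
    {Q : Polynomial (PowerSeries k)}
    (hQ : Q.degree < n)
    (hQ0 : Q.map (PowerSeries.constantCoeff (R := k)) = C b * X ^ (n - e)) :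
    ∃ T : PowerSeries k, PowerSeries.constantCoeff T = z ∧ T ^ n = Q.eval T := by
  have hz' : PowerSeries.constantCoeff (PowerSeries.C z) = z := PowerSeries.constantCoeff_C z
  obtain ⟨T, hT, hTz⟩ := HenselianRing.is_henselian (I := Ideal.span {PowerSeries.X})
    (X ^ n - Q) (monic_X_pow_sub hQ) (PowerSeries.C z)
    (by
      rw [Ideal.mem_span_singleton, PowerSeries.X_dvd_iff, constantCoeff_eval_powerSeries,
        Polynomial.map_sub, hQ0, hz']
      simp [← hz, ← pow_add, Nat.add_sub_cancel' hen])
    ((Polynomial.isUnit_eval_derivative_powerSeries he hen hb hQ0 (by rw [hz', hz])).map _)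
  refine ⟨T, ?_, ?_⟩
  · rw [Ideal.mem_span_singleton, PowerSeries.X_dvd_iff, map_sub, hz'] at hTz
    exact sub_eq_zero.mp hTz
  · rw [IsRoot, eval_sub, eval_pow, eval_X] at hT
    exact sub_eq_zero.mp hT

theorem Polynomial.powerSeries_eq_of_pow_eq_eval {k : Type*} [Field k] [CharZero k] {n e : ℕ}
    (he : e ≠ 0) (hen : e ≤ n) {b : k} (hb : b ≠ 0) {Q : Polynomial (PowerSeries k)}
    (hQ0 : Q.map (PowerSeries.constantCoeff (R := k)) = C b * X ^ (n - e))
    {S T : PowerSeries k} (hST : PowerSeries.constantCoeff S = PowerSeries.constantCoeff T)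
    (hTb : PowerSeries.constantCoeff T ^ e = b)
    (hS : S ^ n = Q.eval S) (hT : T ^ n = Q.eval T) : S = T := by
  obtain ⟨c, hc⟩ := (X ^ n - Q).binomExpansion T (S - T)
  have hu := Polynomial.isUnit_eval_derivative_powerSeries he hen hb hQ0 hTb
  set D := (X ^ n - Q).derivative.eval T
  have hST0 : PowerSeries.constantCoeff (S - T) = 0 := by rw [map_sub, hST, sub_self]
  have hu' : IsUnit (D + c * (S - T)) := by
    rw [PowerSeries.isUnit_iff_constantCoeff] at hu ⊢
    rwa [map_add, map_mul, hST0, mul_zero, add_zero]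
  rw [add_sub_cancel, eval_sub, eval_sub, eval_pow, eval_pow, eval_X, eval_X, hS, hT, sub_self,
    sub_self, zero_add] at hc
  have h0 : (D + c * (S - T)) * (S - T) = 0 := by linear_combination -hc
  exact sub_eq_zero.mp (hu'.mul_right_eq_zero.mp h0)

theorem monodromyPoly.natDegree_eq {K : Type*} [Field K] (f : K[X]) :
    (monodromyPoly K f).natDegree = f.natDegree := by
  rw [monodromyPoly, natDegree_sub_C, natDegree_map]

theorem monodromyPoly.exists_parts_partition {K L R k : Type*} [Field K] [Field L]
    [Field k] [IsAlgClosed k] (f : K[X]) (hf : f.natDegree ≠ 0) (g : K →+* L) (t : L)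
    (ht : ∀ q : K[X], q.eval₂ g t = 0 → q = 0)
    (τ : L →+* L) (hτg : ∀ x, τ (g x) = g x) (hτt : τ t = t)
    (s : Finset R) (e : R → ℕ) (b ξ : R → k) (ρ : R → k → L)
    (he : ∀ r ∈ s, e r ≠ 0) (hb : ∀ r ∈ s, b r ≠ 0)
    (hξ : ∀ r ∈ s, IsPrimitiveRoot (ξ r) (e r))
    (hroot : ∀ r ∈ s, ∀ z, z ^ e r = b r → f.eval₂ g (ρ r z) = t)
    (hinj : ∀ r ∈ s, ∀ z, z ^ e r = b r → ∀ r' ∈ s, ∀ z', z' ^ e r' = b r' →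
      ρ r z = ρ r' z' → r = r' ∧ z = z')
    (hτ : ∀ r ∈ s, ∀ z, z ^ e r = b r → τ (ρ r z) = ρ r (ξ r * z))
    (hsum : ∑ r ∈ s, e r = f.natDegree) :
    ∃ σ : (monodromyPoly K f).Gal, (MulAction.toPerm σ :
      Equiv.Perm ((monodromyPoly K f).rootSet
        (monodromyPoly K f).SplittingField)).partition.parts = s.val.map e := by
  let φ : RatFunc K →+* L := RatFunc.liftRingHom (eval₂RingHom g t) (by
    intro q hq
    rw [Submonoid.mem_comap, mem_nonZeroDivisors_iff_ne_zero]
    exact fun h => nonZeroDivisors.ne_zero hq (ht q h))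
  have hφp : ∀ q : K[X], φ (algebraMap K[X] (RatFunc K) q) = q.eval₂ g t := fun q =>
    RatFunc.liftRingHom_algebraMap _ _ _
  have hφ : ∀ y, τ (φ y) = φ y := by
    have : (τ.comp φ) = φ := by
      apply IsFractionRing.ringHom_ext (A := K[X])
      intro q
      rw [RingHom.comp_apply, hφp, hom_eval₂, hτt]
      congr 1
      exact RingHom.ext hτg
    exact fun y => RingHom.congr_fun this y
  let _ : Algebra (RatFunc K) L := φ.toAlgebra
  let τ' : L →ₐ[RatFunc K] L := { τ with commutes' := hφ }
  refine Polynomial.Gal.exists_parts_partition (monodromyPoly K f) ?_ τ' s e b ξ ρ he hb hξ ?_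
    hinj hτ (hsum.trans (monodromyPoly.natDegree_eq f).symm)
  · intro h
    apply hf
    rw [← monodromyPoly.natDegree_eq, h, natDegree_zero]
  · intro r hr z hz
    have h1 : φ.comp (algebraMap K (RatFunc K)) = g := by
      ext x
      rw [RingHom.comp_apply, IsScalarTower.algebraMap_apply K K[X] (RatFunc K), hφp]
      simp
    have h2 : φ RatFunc.X = t := by
      rw [← RatFunc.algebraMap_X, hφp, eval₂_X]
    rw [monodromyPoly, aeval_def, eval₂_sub, eval₂_map, eval₂_C]
    change eval₂ (φ.comp _) _ f - φ RatFunc.X = 0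
    rw [h1, h2, hroot r hr z hz, sub_self]

theorem monodromyPoly.exists_parts_partition_of_powerSeries {K L R k : Type*} [Field K] [Field k]
    [IsAlgClosed k] [Field L] [Algebra (PowerSeries k) L] [IsFractionRing (PowerSeries k) L]
    (i : K →+* k) (f : K[X]) (hf : f.natDegree ≠ 0) (g : k →+* L)
    (hg : g = (algebraMap (PowerSeries k) L).comp PowerSeries.C) (t : L) (ht : t ∉ g.range)
    {ζ : k} (τ : L →+* L)
    (hτa : ∀ a, τ (algebraMap (PowerSeries k) L a) = algebraMap _ L (PowerSeries.rescale ζ a))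
    (hτt : τ t = t)
    (s : Finset R) (e : R → ℕ) (b ξ : R → k) (κ : R → PowerSeries k → L)
    (he : ∀ r ∈ s, e r ≠ 0) (hb : ∀ r ∈ s, b r ≠ 0)
    (hξ : ∀ r ∈ s, IsPrimitiveRoot (ξ r) (e r))
    (hex : ∀ r ∈ s, ∀ z, z ^ e r = b r → ∃ T, PowerSeries.constantCoeff T = z ∧
      (f.map i).eval₂ g (κ r T) = t)
    (huniq : ∀ r ∈ s, ∀ S T, PowerSeries.constantCoeff S = PowerSeries.constantCoeff T →
      PowerSeries.constantCoeff T ^ e r = b r → (f.map i).eval₂ g (κ r S) = t →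
      (f.map i).eval₂ g (κ r T) = t → S = T)
    (hinj : ∀ r ∈ s, ∀ S, PowerSeries.constantCoeff S ≠ 0 → ∀ r' ∈ s, ∀ T,
      PowerSeries.constantCoeff T ≠ 0 → κ r S = κ r' T →
      r = r' ∧ PowerSeries.constantCoeff S = PowerSeries.constantCoeff T)
    (hτ : ∀ r ∈ s, ∀ T, PowerSeries.constantCoeff T ≠ 0 →
      τ (κ r T) = κ r (PowerSeries.C (ξ r) * PowerSeries.rescale ζ T))
    (hsum : ∑ r ∈ s, e r = f.natDegree) :
    ∃ σ : (monodromyPoly K f).Gal, (MulAction.toPerm σ :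
      Equiv.Perm ((monodromyPoly K f).rootSet
        (monodromyPoly K f).SplittingField)).partition.parts = s.val.map e := by
  have hne : ∀ r ∈ s, ∀ z, z ^ e r = b r → z ≠ 0 := by
    rintro r hr z hz rfl
    rw [zero_pow (he r hr)] at hz
    exact hb r hr hz.symm
  have hτg : ∀ x, τ (g x) = g x := by
    intro x
    rw [hg, RingHom.comp_apply, hτa]
    congr 1
    ext n
    rw [PowerSeries.coeff_rescale, PowerSeries.coeff_C]
    split_ifs with h <;> simp [h]
  choose! T hT0 hT using hex
  refine monodromyPoly.exists_parts_partition f hf (g.comp i) t ?_ τ (fun x => hτg _) hτt s e b ξ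
    (fun r z => κ r (T r z)) he hb hξ ?_ ?_ ?_ hsum
  · intro q hq
    by_contra hq0
    apply ht
    refine (IsAlgClosed.splits (q.map i)).mem_range_of_isRoot (Polynomial.map_ne_zero hq0) ?_
    rwa [IsRoot, map_map, eval_map]
  · intro r hr z hz
    rw [← eval₂_map]
    exact hT r hr z hz
  · intro r hr z hz r' hr' z' hz' h
    have := hinj r hr _ (by rw [hT0 r hr z hz]; exact hne r hr z hz) r' hr' _
      (by rw [hT0 r' hr' z' hz']; exact hne r' hr' z' hz') h
    rwa [hT0 r hr z hz, hT0 r' hr' z' hz'] at this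
  · intro r hr z hz
    have hz' : (ξ r * z) ^ e r = b r := by rw [mul_pow, (hξ r hr).pow_eq_one, one_mul, hz]
    have hcc : PowerSeries.constantCoeff (T r z) ≠ 0 := by
      rw [hT0 r hr z hz]
      exact hne r hr z hz
    have hccξ : PowerSeries.constantCoeff (PowerSeries.C (ξ r) * PowerSeries.rescale ζ (T r z)) =
        ξ r * z := by
      rw [map_mul, PowerSeries.constantCoeff_C, ← PowerSeries.coeff_zero_eq_constantCoeff_apply,
        PowerSeries.coeff_rescale, PowerSeries.coeff_zero_eq_constantCoeff_apply, hT0 r hr z hz,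
        pow_zero, one_mul]
    change τ (κ r (T r z)) = κ r (T r (ξ r * z))
    rw [hτ r hr _ hcc]
    congr 1
    refine huniq r hr _ _ (hccξ.trans (hT0 r hr _ hz').symm) ?_ ?_ (hT r hr _ hz')
    · rw [hT0 r hr _ hz', hz']
    · rw [← hτ r hr _ hcc]
      have := congrArg τ (hT r hr z hz)
      rwa [hom_eval₂, hτt, show τ.comp g = g from RingHom.ext hτg] at this

theorem Polynomial.sum_coeff_mul_pow_mul_pow {k L : Type*} [CommSemiring k] [Field L] (u : k[X])
    (g : k →+* L) {d : ℕ} (hd : u.natDegree ≤ d) {x : L} (hx : x ≠ 0) (y : L) :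
    ∑ j ∈ Finset.range (d + 1), g (u.coeff j) * y ^ j * x ^ (d - j) =
      x ^ d * u.eval₂ g (y / x) := by
  rw [eval₂_eq_sum_range' g (Nat.lt_succ_of_le hd), Finset.mul_sum]
  refine Finset.sum_congr rfl fun j hj => ?_
  have hjd : j ≤ d := Nat.lt_succ_iff.mp (Finset.mem_range.mp hj)
  rw [div_pow, pow_sub₀ x hx hjd]
  field_simp

section

variable {k L : Type*} [Field k] [Field L] [Algebra (PowerSeries k) L]
  [IsFractionRing (PowerSeries k) L]

theorem algebraMap_powerSeries_ne_zero {T : PowerSeries k}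
    (hT : PowerSeries.constantCoeff T ≠ 0) : algebraMap (PowerSeries k) L T ≠ 0 := by
  rw [Ne, IsFractionRing.to_map_eq_zero_iff]
  rintro rfl
  exact hT (map_zero _)

theorem algebraMap_powerSeries_X_ne_zero : algebraMap (PowerSeries k) L PowerSeries.X ≠ 0 := by
  rw [Ne, IsFractionRing.to_map_eq_zero_iff]
  exact PowerSeries.X_ne_zero

/-- The equation `T ^ n = finiteBranchPoly u m d` in `T` describes the branches
`r + w ^ m / T` of the polynomial function `r + Y ↦ Y ^ (n - d) * u(Y)` over `w ^ (m * (n - d))`,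
where `w` is the variable of the power series ring. -/
def finiteBranchPoly (u : k[X]) (m d : ℕ) : Polynomial (PowerSeries k) :=
  ∑ j ∈ Finset.range (d + 1),
    C (PowerSeries.C (u.coeff j) * (PowerSeries.X ^ m) ^ j) * X ^ (d - j)

/-- The equation `T ^ n = infiniteBranchPoly f n` in `T` describes the branches
`T / w` of the polynomial function `f` of degree `n` over `(w ^ n)⁻¹`,
where `w` is the variable of the power series ring. -/
def infiniteBranchPoly (f : k[X]) (n : ℕ) : Polynomial (PowerSeries k) :=
  C (PowerSeries.C (f.coeff n)⁻¹) *
    (1 - ∑ j ∈ Finset.range n, C (PowerSeries.C (f.coeff j) * PowerSeries.X ^ (n - j)) * X ^ j)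

theorem degree_finiteBranchPoly_lt (u : k[X]) (m d : ℕ) {n : ℕ} (hdn : d < n) :
    (finiteBranchPoly u m d).degree < n := by
  refine (degree_sum_le _ _).trans_lt ((Finset.sup_lt_iff (WithBot.bot_lt_coe n)).mpr ?_)
  intro j _
  refine (degree_C_mul_X_pow_le _ _).trans_lt ?_
  exact Nat.cast_lt.mpr ((Nat.sub_le d j).trans_lt hdn)

theorem map_finiteBranchPoly (u : k[X]) {m : ℕ} (hm : m ≠ 0) (d : ℕ) :
    (finiteBranchPoly u m d).map (PowerSeries.constantCoeff (R := k)) =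
      C (u.coeff 0) * X ^ d := by
  rw [finiteBranchPoly, Polynomial.map_sum, Finset.sum_range_succ', Finset.sum_eq_zero]
  · simp
  · intro j _
    simp [hm]

theorem degree_infiniteBranchPoly_lt (f : k[X]) {n : ℕ} (hn : n ≠ 0) :
    (infiniteBranchPoly f n).degree < n := by
  have h0 : (0 : WithBot ℕ) < n := by exact_mod_cast Nat.pos_of_ne_zero hn
  rw [infiniteBranchPoly, C_mul']
  refine (degree_smul_le _ _).trans_lt ((degree_sub_le _ _).trans_lt (max_lt ?_ ?_))
  · exact degree_one_le.trans_lt h0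
  refine (degree_sum_le _ _).trans_lt ((Finset.sup_lt_iff (WithBot.bot_lt_coe n)).mpr ?_)
  intro j hj
  refine (degree_C_mul_X_pow_le _ _).trans_lt ?_
  exact Nat.cast_lt.mpr (Finset.mem_range.mp hj)

theorem map_infiniteBranchPoly (f : k[X]) (n : ℕ) :
    (infiniteBranchPoly f n).map (PowerSeries.constantCoeff (R := k)) =
      C (f.coeff n)⁻¹ * X ^ (n - n) := by
  rw [infiniteBranchPoly, Polynomial.map_mul, Polynomial.map_sub, Polynomial.map_sum,
    Finset.sum_eq_zero]
  · simp
  · intro j hj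
    have := Finset.mem_range.mp hj
    simp [show n - j ≠ 0 by omega]

theorem eval₂_finiteBranch_iff {f v : k[X]} {x r : k} {e d : ℕ} (m : ℕ)
    (hv : f - C x = (X - C r) ^ e * v) (hd : v.natDegree ≤ d) (g : k →+* L)
    (hg : g = (algebraMap (PowerSeries k) L).comp PowerSeries.C) {T : PowerSeries k}
    (hT : PowerSeries.constantCoeff T ≠ 0) :
    f.eval₂ g (g r + algebraMap (PowerSeries k) L PowerSeries.X ^ m / algebraMap _ L T) =
        g x + algebraMap (PowerSeries k) L PowerSeries.X ^ (m * e) ↔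
      T ^ (d + e) = (finiteBranchPoly (taylor r v) m d).eval T := by
  have hT0 := algebraMap_powerSeries_ne_zero (L := L) hT
  have hw0 := algebraMap_powerSeries_X_ne_zero (k := k) (L := L)
  have hQ : algebraMap (PowerSeries k) L ((finiteBranchPoly (taylor r v) m d).eval T) =
      ∑ j ∈ Finset.range (d + 1), g ((taylor r v).coeff j) *
        (algebraMap (PowerSeries k) L PowerSeries.X ^ m) ^ j * algebraMap _ L T ^ (d - j) := by
    rw [finiteBranchPoly, eval_finsetSum, map_sum]
    refine Finset.sum_congr rfl fun j _ => ?_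
    rw [eval_mul, eval_C, eval_pow, eval_X, hg]
    simp only [map_mul, map_pow, RingHom.comp_apply]
  rw [← (IsFractionRing.injective (PowerSeries k) L).eq_iff, hQ,
    sum_coeff_mul_pow_mul_pow _ g (by rwa [natDegree_taylor]) hT0, map_pow, pow_add]
  set w := algebraMap (PowerSeries k) L PowerSeries.X
  set T' := algebraMap (PowerSeries k) L T
  have hf := congrArg (eval₂ g (g r + w ^ m / T')) hv
  rw [eval₂_sub, eval₂_C, eval₂_mul, eval₂_pow, eval₂_sub, eval₂_X, eval₂_C,
    add_sub_cancel_left, div_pow, ← pow_mul] at hf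
  rw [taylor_apply, eval₂_comp, eval₂_add, eval₂_X, eval₂_C, add_comm (w ^ m / T'),
    ← sub_eq_iff_eq_add', hf,
    (mul_right_injective₀ (pow_ne_zero d hT0)).eq_iff, div_mul_eq_mul_div,
    div_eq_iff (pow_ne_zero e hT0), (mul_right_injective₀ (pow_ne_zero (m * e) hw0)).eq_iff,
    eq_comm]

theorem eval₂_infiniteBranch_iff {f : k[X]} {n : ℕ} (hf : f.natDegree ≤ n) (hfn : f.coeff n ≠ 0)
    (g : k →+* L) (hg : g = (algebraMap (PowerSeries k) L).comp PowerSeries.C)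
    (T : PowerSeries k) :
    f.eval₂ g (algebraMap _ L T / algebraMap (PowerSeries k) L PowerSeries.X) =
        (algebraMap (PowerSeries k) L PowerSeries.X ^ n)⁻¹ ↔
      T ^ n = (infiniteBranchPoly f n).eval T := by
  have hw0 := algebraMap_powerSeries_X_ne_zero (k := k) (L := L)
  have hQ : algebraMap (PowerSeries k) L ((infiniteBranchPoly f n).eval T) =
      (g (f.coeff n))⁻¹ * (1 - ∑ j ∈ Finset.range n, g (f.coeff j) * algebraMap _ L T ^ j *
        algebraMap (PowerSeries k) L PowerSeries.X ^ (n - j)) := by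
    rw [infiniteBranchPoly, eval_mul, eval_C, eval_sub, eval_one, eval_finsetSum, map_mul, map_sub,
      map_one, map_sum, ← map_inv₀ g]
    congr 1
    · rw [hg]; rfl
    · congr 1
      refine Finset.sum_congr rfl fun j _ => ?_
      rw [eval_mul, eval_C, eval_pow, eval_X, hg]
      simp only [map_mul, map_pow, RingHom.comp_apply]
      ring
  have hgn : g (f.coeff n) ≠ 0 := (_root_.map_ne_zero g).mpr hfn
  have hsum := sum_coeff_mul_pow_mul_pow f g hf hw0 (algebraMap _ L T)
  rw [Finset.sum_range_succ, Nat.sub_self, pow_zero, mul_one] at hsum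
  rw [← (IsFractionRing.injective (PowerSeries k) L).eq_iff, hQ, map_pow,
    eq_inv_mul_iff_mul_eq₀ hgn, eq_sub_iff_add_eq', hsum]
  exact ⟨fun h => by rw [h, mul_inv_cancel₀ (pow_ne_zero n hw0)],
    fun h => eq_inv_of_mul_eq_one_right h⟩

theorem algebraMap_powerSeries_X_pow_notMem_range {n : ℕ} (hn : n ≠ 0) (g : k →+* L)
    (hg : g = (algebraMap (PowerSeries k) L).comp PowerSeries.C) :
    algebraMap (PowerSeries k) L PowerSeries.X ^ n ∉ g.range := by
  rintro ⟨c, hc⟩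
  rw [hg, RingHom.comp_apply, ← map_pow] at hc
  have h := IsFractionRing.injective (PowerSeries k) L hc
  have h0 := congrArg PowerSeries.constantCoeff h
  rw [PowerSeries.constantCoeff_C, map_pow, PowerSeries.constantCoeff_X, zero_pow hn] at h0
  rw [h0, map_zero] at h
  exact pow_ne_zero n PowerSeries.X_ne_zero h.symm

theorem exists_ringHom_algebraMap_rescale {ζ : k} (hζ : ζ ≠ 0) :
    ∃ τ : L →+* L, ∀ a, τ (algebraMap (PowerSeries k) L a) =
      algebraMap _ L (PowerSeries.rescale ζ a) :=
  ⟨IsFractionRing.map (PowerSeries.rescale_injective hζ), fun a => IsLocalization.map_eq _ a⟩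

end

/-- The monodromy group contains a permutation whose cycle lengths are the multiplicities of the
roots of `f - x`: the generator `w ↦ ζ * w` of inertia over `x`. -/
theorem monodromyPoly.exists_parts_partition_eq_map_count {K k : Type*} [Field K] [Field k]
    [CharZero k] [IsAlgClosed k] (i : K →+* k) (f : K[X]) (hf : f.natDegree ≠ 0) (x : k) :
    ∃ σ : (monodromyPoly K f).Gal, (MulAction.toPerm σ :
      Equiv.Perm ((monodromyPoly K f).rootSet
        (monodromyPoly K f).SplittingField)).partition.parts =
      ((f.map i - C x).roots.toFinset.val).map (fun r => (f.map i - C x).roots.count r) := by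
  let L := FractionRing (PowerSeries k)
  let g : k →+* L := (algebraMap (PowerSeries k) L).comp PowerSeries.C
  have hgc : ∀ c, algebraMap (PowerSeries k) L (PowerSeries.C c) = g c := fun _ => rfl
  set w : L := algebraMap (PowerSeries k) L PowerSeries.X with hw
  have hw0 : w ≠ 0 := algebraMap_powerSeries_X_ne_zero
  set h : k[X] := f.map i - C x with hh
  set n := f.natDegree with hn
  have hhn : h.natDegree = n := by rw [hh, natDegree_sub_C, natDegree_map]
  have hh0 : h ≠ 0 := fun h0 => hf (by rw [← hhn, h0, natDegree_zero])
  set e : k → ℕ := fun r => h.roots.count r with he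
  set m : k → ℕ := fun r => n.factorial / e r with hm
  have hsum : ∑ r ∈ h.roots.toFinset, e r = n := by
    rw [he, Multiset.toFinset_sum_count_eq, ← hhn]
    exact splits_iff_card_roots.mp (IsAlgClosed.splits h)
  have he0 : ∀ r ∈ h.roots.toFinset, e r ≠ 0 := fun r hr =>
    Multiset.count_ne_zero.mpr (Multiset.mem_toFinset.mp hr)
  have hen : ∀ r ∈ h.roots.toFinset, e r ≤ n := fun r hr =>
    hsum ▸ Finset.single_le_sum (f := e) (fun _ _ => Nat.zero_le _) hr
  have hme : ∀ r ∈ h.roots.toFinset, m r * e r = n.factorial := fun r hr =>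
    Nat.div_mul_cancel (Nat.dvd_factorial (Nat.pos_of_ne_zero (he0 r hr)) (hen r hr))
  have hm0 : ∀ r ∈ h.roots.toFinset, m r ≠ 0 := fun r hr h0 =>
    n.factorial_ne_zero (by rw [← hme r hr, h0, zero_mul])
  have hfac : ∀ r, ∃ v : k[X], h = (X - C r) ^ e r * v ∧ ¬ (X - C r) ∣ v := by
    intro r
    simp only [he, count_roots]
    exact exists_eq_pow_rootMultiplicity_mul_and_not_dvd h hh0 r
  choose v hv hvr using hfac
  have hvdeg : ∀ r, (v r).natDegree = n - e r := by
    intro r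
    have hv0 : v r ≠ 0 := fun h0 => hh0 (by rw [hv r, h0, mul_zero])
    have := congrArg natDegree (hv r)
    rw [natDegree_mul (pow_ne_zero _ (X_sub_C_ne_zero r)) hv0, natDegree_pow, natDegree_X_sub_C,
      mul_one, hhn] at this
    omega
  have hb : ∀ r, (taylor r (v r)).coeff 0 ≠ 0 := by
    intro r h0
    rw [taylor_coeff_zero] at h0
    exact hvr r (dvd_iff_isRoot.mpr h0)
  have : NeZero n.factorial := ⟨n.factorial_ne_zero⟩
  obtain ⟨ζ, hζ⟩ := HasEnoughRootsOfUnity.exists_primitiveRoot k n.factorial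
  have hζ0 : ζ ≠ 0 := hζ.ne_zero n.factorial_ne_zero
  obtain ⟨τ, hτ⟩ := exists_ringHom_algebraMap_rescale (L := L) hζ0
  have hτg : ∀ c, τ (g c) = g c := by
    intro c
    rw [← hgc, hτ]
    congr 1
    ext j
    rw [PowerSeries.coeff_rescale, PowerSeries.coeff_C]
    split_ifs with hj <;> simp [hj]
  have hτw : τ w = g ζ * w := by rw [hw, hτ, PowerSeries.rescale_X, map_mul, hgc]
  have hiff : ∀ r ∈ h.roots.toFinset, ∀ T : PowerSeries k, PowerSeries.constantCoeff T ≠ 0 →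
      ((f.map i).eval₂ g (g r + w ^ m r / algebraMap _ L T) = g x + w ^ n.factorial ↔
        T ^ n = (finiteBranchPoly (taylor r (v r)) (m r) (n - e r)).eval T) := by
    intro r hr T hT
    have := eval₂_finiteBranch_iff (m r) (hv r) (hvdeg r).le g rfl hT
    rwa [hme r hr, Nat.sub_add_cancel (hen r hr)] at this
  refine monodromyPoly.exists_parts_partition_of_powerSeries i f hf g rfl (g x + w ^ n.factorial)
    ?_ τ hτ ?_ h.roots.toFinset e (fun r => (taylor r (v r)).coeff 0)
    (fun r => (ζ ^ m r)⁻¹) (fun r T => g r + w ^ m r / algebraMap _ L T) he0 (fun r _ => hb r)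
    ?_ ?_ ?_ ?_ ?_ hsum
  · intro hmem
    refine algebraMap_powerSeries_X_pow_notMem_range n.factorial_ne_zero g rfl ?_
    have := g.range.sub_mem hmem ⟨x, rfl⟩
    rwa [add_sub_cancel_left] at this
  · rw [map_add, hτg, map_pow, hτw, mul_pow, ← map_pow, hζ.pow_eq_one, map_one, one_mul]
  · intro r hr
    exact (hζ.pow n.factorial_pos (hme r hr).symm).inv
  · intro r hr z hz
    obtain ⟨T, hT, hTn⟩ := exists_powerSeries_pow_eq_eval (he0 r hr) (hen r hr) (hb r) hz
      (degree_finiteBranchPoly_lt (taylor r (v r)) (m r) (n - e r)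
        (Nat.sub_lt (Nat.pos_of_ne_zero hf) (Nat.pos_of_ne_zero (he0 r hr))))
      (map_finiteBranchPoly _ (hm0 r hr) _)
    refine ⟨T, hT, (hiff r hr T ?_).mpr hTn⟩
    rw [hT]
    rintro rfl
    rw [zero_pow (he0 r hr)] at hz
    exact hb r hz.symm
  · intro r hr S T hST hTb hS hT
    have hT0 : PowerSeries.constantCoeff T ≠ 0 := by
      intro h0
      rw [h0, zero_pow (he0 r hr)] at hTb
      exact hb r hTb.symm
    exact powerSeries_eq_of_pow_eq_eval (he0 r hr) (hen r hr) (hb r)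
      (map_finiteBranchPoly _ (hm0 r hr) _) hST hTb
      ((hiff r hr S (hST ▸ hT0)).mp hS) ((hiff r hr T hT0).mp hT)
  · intro r hr S hS r' hr' T hT heq
    have hS0 : algebraMap (PowerSeries k) L S ≠ 0 := algebraMap_powerSeries_ne_zero hS
    have hT0 : algebraMap (PowerSeries k) L T ≠ 0 := algebraMap_powerSeries_ne_zero hT
    have hrr : r = r' := by
      have h1 : (PowerSeries.C r * S + PowerSeries.X ^ m r) * T =
          (PowerSeries.C r' * T + PowerSeries.X ^ m r') * S := by
        apply IsFractionRing.injective (PowerSeries k) L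
        simp only [map_mul, map_add, map_pow, hgc, ← hw]
        rw [← div_eq_div_iff hS0 hT0, add_div, add_div, mul_div_cancel_right₀ _ hS0,
          mul_div_cancel_right₀ _ hT0]
        exact heq
      have h2 := congrArg PowerSeries.constantCoeff h1
      simp only [map_mul, map_add, map_pow, PowerSeries.constantCoeff_C,
        PowerSeries.constantCoeff_X, zero_pow (hm0 r hr), zero_pow (hm0 r' hr'), add_zero] at h2
      refine mul_right_cancel₀ (mul_ne_zero hS hT) ?_
      linear_combination h2
    refine ⟨hrr, ?_⟩
    subst hrr
    congr 1
    apply IsFractionRing.injective (PowerSeries k) L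
    have h1 := add_left_cancel heq
    rwa [div_eq_div_iff hS0 hT0, (mul_right_injective₀ (pow_ne_zero _ hw0)).eq_iff, eq_comm] at h1
  · intro r hr T _
    simp only [map_add, map_div₀, map_pow, hτg, hτw, hτ, map_mul, hgc, map_inv₀]
    congr 1
    rw [div_mul_eq_div_div, div_inv_eq_mul, mul_pow, mul_comm]

/-- The monodromy group contains a full cycle: the generator `w ↦ ζ * w` of inertia
at infinity. -/
theorem monodromyPoly.exists_parts_partition_eq_singleton {K k : Type*} [Field K] [Field k]
    [CharZero k] [IsAlgClosed k] (i : K →+* k) (f : K[X]) (hf : f.natDegree ≠ 0) :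
    ∃ σ : (monodromyPoly K f).Gal, (MulAction.toPerm σ :
      Equiv.Perm ((monodromyPoly K f).rootSet
        (monodromyPoly K f).SplittingField)).partition.parts = {f.natDegree} := by
  let L := FractionRing (PowerSeries k)
  let g : k →+* L := (algebraMap (PowerSeries k) L).comp PowerSeries.C
  have hgc : ∀ c, algebraMap (PowerSeries k) L (PowerSeries.C c) = g c := fun _ => rfl
  set w : L := algebraMap (PowerSeries k) L PowerSeries.X with hw
  have hw0 : w ≠ 0 := algebraMap_powerSeries_X_ne_zero
  set n := f.natDegree with hn
  have hfn : (f.map i).coeff n ≠ 0 := by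
    rw [coeff_map, _root_.map_ne_zero, hn, coeff_natDegree, leadingCoeff_ne_zero]
    rintro rfl
    exact hf natDegree_zero
  have hb : ((f.map i).coeff n)⁻¹ ≠ 0 := inv_ne_zero hfn
  have : NeZero n := ⟨hf⟩
  obtain ⟨ζ, hζ⟩ := HasEnoughRootsOfUnity.exists_primitiveRoot k n
  have hζ0 : ζ ≠ 0 := hζ.ne_zero hf
  obtain ⟨τ, hτ⟩ := exists_ringHom_algebraMap_rescale (L := L) hζ0
  have hτw : τ w = g ζ * w := by rw [hw, hτ, PowerSeries.rescale_X, map_mul, hgc]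
  have hiff : ∀ T : PowerSeries k,
      ((f.map i).eval₂ g (algebraMap _ L T / w) = (w ^ n)⁻¹ ↔
        T ^ n = (infiniteBranchPoly (f.map i) n).eval T) := fun T =>
    eval₂_infiniteBranch_iff natDegree_map_le hfn g rfl T
  obtain ⟨σ, hσ⟩ := monodromyPoly.exists_parts_partition_of_powerSeries i f hf g rfl (w ^ n)⁻¹
    (fun ⟨c, hc⟩ => algebraMap_powerSeries_X_pow_notMem_range (L := L) hf g rfl
      ⟨c⁻¹, by rw [map_inv₀, hc, inv_inv]⟩) τ hτ
    (by rw [map_inv₀, map_pow, hτw, mul_pow, ← map_pow, hζ.pow_eq_one, map_one, one_mul])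
    {()} (fun _ => n) (fun _ => ((f.map i).coeff n)⁻¹) (fun _ => ζ⁻¹)
    (fun _ T => algebraMap _ L T / w) (fun _ _ => hf) (fun _ _ => hb) (fun _ _ => hζ.inv)
    (fun _ _ z hz => by
      obtain ⟨T, hT, hTn⟩ := exists_powerSeries_pow_eq_eval hf le_rfl hb hz
        (degree_infiniteBranchPoly_lt (f.map i) hf) (map_infiniteBranchPoly _ _)
      exact ⟨T, hT, (hiff T).mpr hTn⟩)
    (fun _ _ S T hST hTb hS hT => powerSeries_eq_of_pow_eq_eval hf le_rfl hb
      (map_infiniteBranchPoly _ _) hST hTb ((hiff S).mp hS) ((hiff T).mp hT))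
    (fun _ _ S _ _ _ T _ heq => ⟨rfl, by
      rw [IsFractionRing.injective (PowerSeries k) L ((div_left_inj' hw0).mp heq)]⟩)
    (fun _ _ T _ => by
      simp only [map_div₀, hτw, hτ, map_mul, hgc, map_inv₀]
      rw [div_mul_eq_div_div, div_eq_inv_mul _ (g ζ)])
    (by rw [Finset.sum_singleton])
  exact ⟨σ, by simpa using hσ⟩

/-- **Lemma.** Let `char K = 0`, `f ∈ K[x]` of degree `n ≥ 1`, and `x₀` in an algebraic closure
of `K`. If `e₁, …, e_k` are the multiplicities of the distinct roots of `f(x) − x₀`, then the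
monodromy group of `f` contains a permutation of the roots of `f(X) − t` whose cycle lengths
(counting fixed points as cycles of length 1) are exactly `e₁, …, e_k`; furthermore, it
contains an `n`-cycle. -/
theorem stmt10 {K : Type*} [Field K] [CharZero K] (f : K[X]) (n : ℕ) (hn : 1 ≤ n)
    (hdeg : f.natDegree = n) (x₀ : AlgebraicClosure K) :
    (∃ σ : (monodromyPoly K f).Gal,
      (MulAction.toPerm σ :
          Equiv.Perm ((monodromyPoly K f).rootSet
            (monodromyPoly K f).SplittingField)).partition.parts =
        ((f.map (algebraMap K (AlgebraicClosure K)) - C x₀).roots.toFinset.val).map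
          (fun r => (f.map (algebraMap K (AlgebraicClosure K)) - C x₀).roots.count r)) ∧
    (∃ σ : (monodromyPoly K f).Gal,
      (MulAction.toPerm σ :
          Equiv.Perm ((monodromyPoly K f).rootSet
            (monodromyPoly K f).SplittingField)).partition.parts = {n}) := by
  have hf : f.natDegree ≠ 0 := by omega
  refine ⟨monodromyPoly.exists_parts_partition_eq_map_count _ f hf x₀, ?_⟩
  rw [← hdeg]
  exact monodromyPoly.exists_parts_partition_eq_singleton
    (algebraMap K (AlgebraicClosure K)) f hf
end
end

section
/- For every integer n ≥ 3, the polynomial f(x) = (1 + x)^n − x^n (over ℚ) has no three pairwise distinct critical points (in ℂ) at which f takes the same value; moreover, for every integer n ≥ 4 it has at least two distinct critical points. -/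
open Polynomial

noncomputable section

theorem aeval_derivative_one_add_pow_sub_pow_eq_zero_iff {n : ℕ} (hn : n ≠ 0) (z : ℂ) :
    aeval z (derivative ((1 + X) ^ n - X ^ n : ℚ[X])) = 0 ↔ (1 + z) ^ (n - 1) = z ^ (n - 1) := by
  have h : aeval z (derivative ((1 + X) ^ n - X ^ n : ℚ[X])) =
      n * ((1 + z) ^ (n - 1) - z ^ (n - 1)) := by
    simp [derivative_pow]
    ring
  rw [h, mul_eq_zero, sub_eq_zero]
  simp [hn]

/-- The value of `(1 + x) ^ n - x ^ n` at a critical point `z` is `z ^ (n - 1)`. -/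
theorem aeval_one_add_pow_sub_pow {n : ℕ} (hn : n ≠ 0) {z : ℂ}
    (hz : (1 + z) ^ (n - 1) = z ^ (n - 1)) :
    aeval z ((1 + X) ^ n - X ^ n : ℚ[X]) = z ^ (n - 1) := by
  obtain ⟨m, rfl⟩ := Nat.exists_eq_succ_of_ne_zero hn
  simp only [Nat.succ_eq_add_one, Nat.add_sub_cancel] at hz ⊢
  simp only [map_sub, map_pow, map_add, map_one, aeval_X]
  rw [pow_succ, pow_succ, hz]
  ring

theorem normSq_eq_of_pow_eq_pow {m : ℕ} (hm : m ≠ 0) {z w : ℂ} (h : z ^ m = w ^ m) :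
    Complex.normSq z = Complex.normSq w := by
  have h' := congrArg Complex.normSq h
  rw [map_pow, map_pow] at h'
  exact (pow_left_inj₀ (Complex.normSq_nonneg _) (Complex.normSq_nonneg _) hm).1 h'

theorem re_eq_neg_half_of_one_add_pow_eq_pow {m : ℕ} (hm : m ≠ 0) {z : ℂ}
    (h : (1 + z) ^ m = z ^ m) : z.re = -1 / 2 := by
  have h' := normSq_eq_of_pow_eq_pow hm h
  simp only [Complex.normSq_apply, Complex.add_re, Complex.add_im, Complex.one_re,
    Complex.one_im] at h'
  linarith

theorem one_add_inv_sub_one_pow {m : ℕ} {w : ℂ} (hw : w ^ m = 1) (hw1 : w ≠ 1) :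
    (1 + (w - 1)⁻¹) ^ m = ((w - 1)⁻¹) ^ m := by
  have h0 : w - 1 ≠ 0 := sub_ne_zero.2 hw1
  have h : 1 + (w - 1)⁻¹ = w * (w - 1)⁻¹ := by
    field_simp
    ring
  rw [h, mul_pow, hw, one_mul]

/-- **Lemma.** For every `n ≥ 3`, the polynomial `f(x) = (1 + x)^n − x^n` (over `ℚ`) has no
three pairwise distinct complex critical points at which `f` takes the same value; moreover,
for every `n ≥ 4` it has at least two distinct critical points. -/
theorem stmt15 (n : ℕ) (hn : 3 ≤ n) :
    (¬ ∃ α β γ : ℂ, α ≠ β ∧ α ≠ γ ∧ β ≠ γ ∧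
      aeval α (derivative ((1 + X) ^ n - X ^ n : ℚ[X])) = 0 ∧
      aeval β (derivative ((1 + X) ^ n - X ^ n : ℚ[X])) = 0 ∧
      aeval γ (derivative ((1 + X) ^ n - X ^ n : ℚ[X])) = 0 ∧
      aeval α ((1 + X) ^ n - X ^ n : ℚ[X]) = aeval β ((1 + X) ^ n - X ^ n : ℚ[X]) ∧
      aeval β ((1 + X) ^ n - X ^ n : ℚ[X]) = aeval γ ((1 + X) ^ n - X ^ n : ℚ[X])) ∧
    (4 ≤ n → ∃ α β : ℂ, α ≠ β ∧
      aeval α (derivative ((1 + X) ^ n - X ^ n : ℚ[X])) = 0 ∧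
      aeval β (derivative ((1 + X) ^ n - X ^ n : ℚ[X])) = 0) := by
  have hn0 : n ≠ 0 := by omega
  have hm : n - 1 ≠ 0 := by omega
  simp only [aeval_derivative_one_add_pow_sub_pow_eq_zero_iff hn0]
  refine ⟨?_, fun hn4 => ?_⟩
  · rintro ⟨α, β, γ, hαβ, hαγ, hβγ, hα, hβ, hγ, h₁, h₂⟩
    rw [aeval_one_add_pow_sub_pow hn0 hα, aeval_one_add_pow_sub_pow hn0 hβ] at h₁
    rw [aeval_one_add_pow_sub_pow hn0 hβ, aeval_one_add_pow_sub_pow hn0 hγ] at h₂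
    have rα := re_eq_neg_half_of_one_add_pow_eq_pow hm hα
    have rβ := re_eq_neg_half_of_one_add_pow_eq_pow hm hβ
    have rγ := re_eq_neg_half_of_one_add_pow_eq_pow hm hγ
    have n₁ := normSq_eq_of_pow_eq_pow hm h₁
    have n₂ := normSq_eq_of_pow_eq_pow hm h₂
    simp only [Complex.normSq_apply, rα, rβ, rγ] at n₁ n₂
    have i₁ : α.im = -β.im := (mul_self_eq_mul_self_iff.1 (add_left_cancel n₁)).resolve_left
      fun h => hαβ (Complex.ext (rα.trans rβ.symm) h)
    have i₂ : β.im = -γ.im := (mul_self_eq_mul_self_iff.1 (add_left_cancel n₂)).resolve_left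
      fun h => hβγ (Complex.ext (rβ.trans rγ.symm) h)
    exact hαγ (Complex.ext (rα.trans rγ.symm) (by rw [i₁, i₂, neg_neg]))
  · obtain ⟨ζ, hζ⟩ : ∃ ζ : ℂ, IsPrimitiveRoot ζ (n - 1) :=
      ⟨_, Complex.isPrimitiveRoot_exp (n - 1) hm⟩
    have h1 : ζ ≠ 1 := hζ.ne_one (by omega)
    have h2 : ζ ^ 2 ≠ 1 := hζ.pow_ne_one_of_pos_of_lt two_ne_zero (by omega)
    refine ⟨(ζ - 1)⁻¹, (ζ ^ 2 - 1)⁻¹, fun h => h1 ?_,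
      one_add_inv_sub_one_pow hζ.pow_eq_one h1,
      one_add_inv_sub_one_pow (by rw [pow_right_comm, hζ.pow_eq_one, one_pow]) h2⟩
    have h3 : ζ = ζ ^ 2 := sub_left_injective (inv_injective h)
    exact mul_left_cancel₀ (hζ.ne_zero hm) (by rw [mul_one, ← sq, ← h3])
end
end

section
/- Let K be a field with char(K) = 0, let a₁, a₂, a₃ ∈ K with a₁a₂ ≠ 0, and let n₁ > n₂ ≥ 1 be integers with n₁ ≥ 3 and gcd(n₁, n₂) ≤ 2. Then the polynomial f(x) = a₁x^{n₁} + a₂x^{n₂} + a₃ has at least two distinct critical points, and there are no three pairwise distinct critical points of f at which f takes the same value. -/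
open Polynomial

noncomputable section

/-- Two nonzero elements with equal `m`-th powers and equal `n`-th powers have equal
`gcd m n`-th powers. -/
theorem pow_gcd_eq_pow_gcd {L : Type*} [Field L] {x y : L} (hy : y ≠ 0) {m n : ℕ}
    (hm : x ^ m = y ^ m) (hn : x ^ n = y ^ n) : x ^ m.gcd n = y ^ m.gcd n := by
  have h : (x / y) ^ m.gcd n = 1 := by
    refine pow_gcd_eq_one.mpr ⟨?_, ?_⟩
    · rw [div_pow, hm, div_self (pow_ne_zero _ hy)]
    · rw [div_pow, hn, div_self (pow_ne_zero _ hy)]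
  rwa [div_pow, div_eq_one_iff_eq (pow_ne_zero _ hy)] at h

/-- Three pairwise distinct elements of a field cannot have the same `g`-th power if `g ≤ 2` is
positive. -/
theorem not_three_pow_eq_of_le_two {L : Type*} [Field L] {x y z : L} (hxy : x ≠ y) (hxz : x ≠ z)
    (hyz : y ≠ z) {g : ℕ} (hg₀ : 0 < g) (hg : g ≤ 2) (h₁ : x ^ g = y ^ g) (h₂ : x ^ g = z ^ g) :
    False := by
  interval_cases g
  · exact hxy (by simpa using h₁)
  · have h₃ := (sq_eq_sq_iff_eq_or_eq_neg.mp h₁).resolve_left hxy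
    have h₄ := (sq_eq_sq_iff_eq_or_eq_neg.mp h₂).resolve_left hxz
    exact hyz (neg_injective (h₃.symm.trans h₄))

/-- At a critical point of `b₁x^{m+1+d} + b₂x^{m+1}`, the value is determined by `x^{m+1}`. -/
theorem trinomial_value_of_critical {L : Type*} [Field L] {b₁ b₂ x : L} {m d : ℕ}
    (h : b₁ * ((m + 1 + d : ℕ) * x ^ (m + d)) + b₂ * ((m + 1 : ℕ) * x ^ m) = 0) :
    ((m + 1 + d : ℕ) : L) * (b₁ * x ^ (m + 1 + d) + b₂ * x ^ (m + 1)) =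
      d * b₂ * x ^ (m + 1) := by
  push_cast at h ⊢
  linear_combination x * h

/-- Distinct critical points of `b₁x^{m+1+d} + b₂x^{m+1}` at which it takes the same value are
nonzero and agree in their powers of exponents `m + 1` and `d`. -/
theorem pow_eq_pow_of_critical_value_eq {L : Type*} [Field L] [CharZero L] {b₁ b₂ x y : L}
    (hb₁ : b₁ ≠ 0) (hb₂ : b₂ ≠ 0) {m d : ℕ} (hd : 0 < d) (hxy : x ≠ y)
    (hx : b₁ * ((m + 1 + d : ℕ) * x ^ (m + d)) + b₂ * ((m + 1 : ℕ) * x ^ m) = 0)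
    (hy : b₁ * ((m + 1 + d : ℕ) * y ^ (m + d)) + b₂ * ((m + 1 : ℕ) * y ^ m) = 0)
    (h : b₁ * x ^ (m + 1 + d) + b₂ * x ^ (m + 1) = b₁ * y ^ (m + 1 + d) + b₂ * y ^ (m + 1)) :
    y ≠ 0 ∧ x ^ (m + 1) = y ^ (m + 1) ∧ x ^ d = y ^ d := by
  have hd' : (d : L) ≠ 0 := Nat.cast_ne_zero.mpr hd.ne'
  have hn : ((m + 1 + d : ℕ) : L) ≠ 0 := Nat.cast_ne_zero.mpr (by lia)
  have hpow : x ^ (m + 1) = y ^ (m + 1) := by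
    refine mul_left_cancel₀ (mul_ne_zero hd' hb₂) ?_
    rw [← trinomial_value_of_critical hx, ← trinomial_value_of_critical hy, h]
  have hy₀ : y ≠ 0 := by
    rintro rfl
    exact hxy (by simpa using hpow)
  have hx₀ : x ≠ 0 := by
    rintro rfl
    exact hxy (by simpa using hpow.symm : y = 0).symm
  refine ⟨hy₀, hpow, ?_⟩
  have key : ∀ z : L, z ≠ 0 →
      b₁ * ((m + 1 + d : ℕ) * z ^ (m + d)) + b₂ * ((m + 1 : ℕ) * z ^ m) = 0 →
      b₁ * (m + 1 + d : ℕ) * z ^ d = -(b₂ * (m + 1 : ℕ)) := by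
    intro z hz hzc
    refine mul_left_cancel₀ (pow_ne_zero m hz) ?_
    linear_combination hzc
  refine mul_left_cancel₀ (mul_ne_zero hb₁ hn) ?_
  rw [key x hx₀ hx, key y hy₀ hy]

/-- In an algebraically closed field of characteristic zero, `b₁x^{m+1+d} + b₂x^{m+1}` has two
distinct critical points unless it is a quadratic. -/
theorem exists_two_critical_points {L : Type*} [Field L] [CharZero L] [IsAlgClosed L] {b₁ b₂ : L}
    (hb₁ : b₁ ≠ 0) (hb₂ : b₂ ≠ 0) {m d : ℕ} (hd : 0 < d) (hmd : 2 ≤ m + d) :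
    ∃ x y : L, x ≠ y ∧
      b₁ * ((m + 1 + d : ℕ) * x ^ (m + d)) + b₂ * ((m + 1 : ℕ) * x ^ m) = 0 ∧
      b₁ * ((m + 1 + d : ℕ) * y ^ (m + d)) + b₂ * ((m + 1 : ℕ) * y ^ m) = 0 := by
  have hn : ((m + 1 + d : ℕ) : L) ≠ 0 := Nat.cast_ne_zero.mpr (by lia)
  have hm : ((m + 1 : ℕ) : L) ≠ 0 := Nat.cast_ne_zero.mpr (by lia)
  obtain ⟨x, hx⟩ := IsAlgClosed.exists_pow_nat_eq
    (-(b₂ * (m + 1 : ℕ)) / (b₁ * (m + 1 + d : ℕ))) hd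
  have hx₀ : x ≠ 0 := by
    rintro rfl
    rw [zero_pow hd.ne', eq_comm, div_eq_zero_iff, neg_eq_zero] at hx
    exact hx.elim (mul_ne_zero hb₂ hm) (mul_ne_zero hb₁ hn)
  rw [eq_div_iff (mul_ne_zero hb₁ hn)] at hx
  have key : ∀ z : L, z ^ d = x ^ d →
      b₁ * ((m + 1 + d : ℕ) * z ^ (m + d)) + b₂ * ((m + 1 : ℕ) * z ^ m) = 0 := by
    intro z hz
    rw [← hz] at hx
    linear_combination z ^ m * hx
  rcases Nat.eq_zero_or_pos m with rfl | hm₀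
  · have : NeZero (d : L) := ⟨Nat.cast_ne_zero.mpr hd.ne'⟩
    obtain ⟨ζ, hζ⟩ := HasEnoughRootsOfUnity.exists_primitiveRoot L d
    refine ⟨x, ζ * x, fun h ↦ hζ.ne_one (by lia) ?_, key x rfl,
      key _ (by rw [mul_pow, hζ.pow_eq_one, one_mul])⟩
    exact mul_right_cancel₀ hx₀ (by rw [one_mul, ← h])
  · exact ⟨x, 0, hx₀, key x rfl, by simp [hm₀.ne']⟩

/-- **Lemma.** Let `char K = 0`, `a₁a₂ ≠ 0`, and `n₁ > n₂ ≥ 1` with `n₁ ≥ 3` and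
`gcd(n₁, n₂) ≤ 2`. Then `f(x) = a₁x^{n₁} + a₂x^{n₂} + a₃` has at least two distinct critical
points (in an algebraic closure of `K`), and there are no three pairwise distinct critical
points of `f` at which `f` takes the same value. -/
theorem stmt17 {K : Type*} [Field K] [CharZero K] (a₁ a₂ a₃ : K) (ha : a₁ * a₂ ≠ 0)
    (n₁ n₂ : ℕ) (hn₂ : 1 ≤ n₂) (hn : n₂ < n₁) (hn₁ : 3 ≤ n₁) (hgcd : Nat.gcd n₁ n₂ ≤ 2) :
    (∃ α β : AlgebraicClosure K, α ≠ β ∧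
      aeval α (derivative (C a₁ * X ^ n₁ + C a₂ * X ^ n₂ + C a₃)) = 0 ∧
      aeval β (derivative (C a₁ * X ^ n₁ + C a₂ * X ^ n₂ + C a₃)) = 0) ∧
    ¬ ∃ α β γ : AlgebraicClosure K, α ≠ β ∧ α ≠ γ ∧ β ≠ γ ∧
      aeval α (derivative (C a₁ * X ^ n₁ + C a₂ * X ^ n₂ + C a₃)) = 0 ∧
      aeval β (derivative (C a₁ * X ^ n₁ + C a₂ * X ^ n₂ + C a₃)) = 0 ∧
      aeval γ (derivative (C a₁ * X ^ n₁ + C a₂ * X ^ n₂ + C a₃)) = 0 ∧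
      aeval α (C a₁ * X ^ n₁ + C a₂ * X ^ n₂ + C a₃) =
        aeval β (C a₁ * X ^ n₁ + C a₂ * X ^ n₂ + C a₃) ∧
      aeval β (C a₁ * X ^ n₁ + C a₂ * X ^ n₂ + C a₃) =
        aeval γ (C a₁ * X ^ n₁ + C a₂ * X ^ n₂ + C a₃) := by
  obtain ⟨m, rfl⟩ := Nat.exists_eq_add_of_le' hn₂
  obtain ⟨d, rfl⟩ := Nat.exists_eq_add_of_le hn.le
  have hd : 0 < d := by lia
  have hb₁ : algebraMap K (AlgebraicClosure K) a₁ ≠ 0 := by simpa using left_ne_zero_of_mul ha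
  have hb₂ : algebraMap K (AlgebraicClosure K) a₂ ≠ 0 := by simpa using right_ne_zero_of_mul ha
  have hcrit : ∀ z : AlgebraicClosure K,
      aeval z (derivative (C a₁ * X ^ (m + 1 + d) + C a₂ * X ^ (m + 1) + C a₃)) =
        algebraMap K _ a₁ * ((m + 1 + d : ℕ) * z ^ (m + d)) +
          algebraMap K _ a₂ * ((m + 1 : ℕ) * z ^ m) := by
    intro z
    simp only [derivative_C_mul, derivative_X_pow, derivative_C, add_zero,
      map_add, map_mul, map_pow, aeval_C, aeval_X, map_natCast, Nat.add_sub_cancel,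
      Nat.add_right_comm m 1 d]
  simp only [hcrit]
  refine ⟨exists_two_critical_points hb₁ hb₂ hd (by lia), ?_⟩
  rintro ⟨α, β, γ, hαβ, hαγ, hβγ, hα, hβ, hγ, h₁, h₂⟩
  simp only [map_add, map_mul, map_pow, aeval_C, aeval_X, add_left_inj] at h₁ h₂
  obtain ⟨hβ₀, hm₁, hd₁⟩ := pow_eq_pow_of_critical_value_eq hb₁ hb₂ hd hαβ hα hβ h₁
  obtain ⟨hγ₀, hm₂, hd₂⟩ :=
    pow_eq_pow_of_critical_value_eq hb₁ hb₂ hd hαγ hα hγ (h₁.trans h₂)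
  have hg : Nat.gcd (m + 1) d ≤ 2 := by
    rwa [Nat.gcd_comm, Nat.gcd_self_add_right] at hgcd
  exact not_three_pow_eq_of_le_two hαβ hαγ hβγ (Nat.gcd_pos_of_pos_right _ hd) hg
    (pow_gcd_eq_pow_gcd hβ₀ hm₁ hd₁) (pow_gcd_eq_pow_gcd hγ₀ hm₂ hd₂)
end
end
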